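/- arXiv:2104.07110 — 7 statements merged into one kernel-verified Lean document; each statement's English description precedes it below -/
import Mathlib

section
/- Let X be a real Banach space, let T : [0,∞) → B(X) be a strongly continuous semigroup with generator A, and let ω ∈ ℝ, M ≥ 0 satisfy ‖T(t)‖ ≤ M e^{ωt} for all t ≥ 0. Let m ∈ ℕ and let P(x) = Σ_{k=0}^{m+2} a_k x^k be a polynomial with real coefficients and a_{m+2} ≠ 0, and suppose every complex root λ of P satisfies Re(λ) > ω. Let g_P : [0,∞) → ℝ be the unique solution of the initial value problem Σ_{k=0}^{m+2} (−1)^k a_k g^{(k)} = 0 on [0,∞), g(0) = g'(0) = ⋯ = g^{(m)}(0) = 0, g^{(m+1)}(0) = (−1)^m (a_{m+2})^{−1}. Then ∫_0^∞ ‖T(t)‖ |g_P(t)| dt < ∞, the operator P(A) := Σ_{k=0}^{m+2} a_k A^k with domain D(A^{m+2}) is a bijection from D(A^{m+2}) onto X, its inverse P(A)^{−1} is a bounded linear operator on X, and P(A)^{−1} x = ∫_0^∞ g_P(t)·T(t)x dt (Bochner integral) for every x ∈ X. -/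
open MeasureTheory Filter Set Quaternion

noncomputable section

/-- The unnormalized sinc function. -/
def sinc (r : ℝ) : ℝ := if r = 0 then 1 else Real.sin r / r

/-- `T : [0,∞) → B(X)` is a strongly continuous semigroup. -/
def IsSCSemigroup {X : Type*} [NormedAddCommGroup X] [NormedSpace ℝ X]
    (T : ℝ → X →L[ℝ] X) : Prop :=
  T 0 = 1 ∧ (∀ s t : ℝ, 0 ≤ s → 0 ≤ t → T (t + s) = (T t).comp (T s)) ∧
    ∀ x : X, ContinuousOn (fun t => T t x) (Set.Ici 0)

/-- The domain of the generator of `T`. -/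
def genDomain {X : Type*} [NormedAddCommGroup X] [NormedSpace ℝ X]
    (T : ℝ → X →L[ℝ] X) : Set X :=
  {x | ∃ y : X, Tendsto (fun h : ℝ => (1 / h) • (T h x - x)) (nhdsWithin 0 (Set.Ioi 0)) (nhds y)}

/-- `A` is the generator of `T` (its values outside `genDomain T` are irrelevant). -/
def IsGenerator {X : Type*} [NormedAddCommGroup X] [NormedSpace ℝ X]
    (T : ℝ → X →L[ℝ] X) (A : X → X) : Prop :=
  ∀ x ∈ genDomain T,
    Tendsto (fun h : ℝ => (1 / h) • (T h x - x)) (nhdsWithin 0 (Set.Ioi 0)) (nhds (A x))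

/-- `iterDomain T A k` is `D(A^k)`. -/
def iterDomain {X : Type*} [NormedAddCommGroup X] [NormedSpace ℝ X]
    (T : ℝ → X →L[ℝ] X) (A : X → X) : ℕ → Set X
  | 0 => Set.univ
  | k + 1 => {x | x ∈ iterDomain T A k ∧ A^[k] x ∈ genDomain T}

/-- A solution of `u' = -(μ u + f)` on `[0, ∞)` decays at the rate `β < Re μ` if `f` does. -/
lemma exists_exp_bound_of_hasDerivWithinAt {u f : ℝ → ℂ} {μ : ℂ} {β C : ℝ} (hβ : β < μ.re)
    (hu : ∀ t ∈ Ici (0 : ℝ), HasDerivWithinAt u (-(μ * u t + f t)) (Ici 0) t)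
    (hf : ∀ t ∈ Ici (0 : ℝ), ‖f t‖ ≤ C * Real.exp (-β * t)) :
    ∃ K, ∀ t ∈ Ici (0 : ℝ), ‖u t‖ ≤ K * Real.exp (-β * t) := by
  have hC : 0 ≤ C := by simpa using (norm_nonneg _).trans (hf 0 self_mem_Ici)
  set κ := μ.re - β with hκ
  have hκ0 : 0 < κ := sub_pos.2 hβ
  have hderiv : ∀ t ∈ Ici (0 : ℝ), HasDerivWithinAt (fun s : ℝ => Complex.exp (μ * s) * u s)
      (-(Complex.exp (μ * t) * f t)) (Ici 0) t := by
    intro t ht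
    have h1 : HasDerivAt (fun s : ℝ => Complex.exp (μ * s)) (Complex.exp (μ * t) * μ) t := by
      have := ((hasDerivAt_id (t : ℂ)).const_mul μ).cexp.comp_ofReal
      simpa using this
    refine (h1.hasDerivWithinAt.mul (hu t ht)).congr_deriv ?_
    ring
  have hB : ∀ t : ℝ, HasDerivAt (fun s => ‖u 0‖ + C / κ * Real.exp (κ * s))
      (C * Real.exp (κ * t)) t := by
    intro t
    have h1 := ((((hasDerivAt_id t).const_mul κ).exp).const_mul (C / κ)).const_add ‖u 0‖
    refine h1.congr_deriv ?_
    simp only [id]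
    field_simp
  refine ⟨‖u 0‖ + C / κ, fun t ht => ?_⟩
  have hexp : ∀ s : ℝ, ‖Complex.exp (μ * s)‖ = Real.exp (μ.re * s) := by
    intro s; simp [Complex.norm_exp]
  have key := image_norm_le_of_norm_deriv_right_le_deriv_boundary (a := 0) (b := t)
    (f := fun s : ℝ => Complex.exp (μ * s) * u s)
    (f' := fun s : ℝ => -(Complex.exp (μ * s) * f s))
    (fun s hs => ((hderiv s hs.1).continuousWithinAt).mono Icc_subset_Ici_self)
    (fun s hs => (hderiv s hs.1).mono (Ici_subset_Ici.2 hs.1))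
    (by simpa using div_nonneg hC hκ0.le) hB
    (fun s hs => by
      rw [norm_neg, norm_mul, hexp]
      calc Real.exp (μ.re * s) * ‖f s‖ ≤ Real.exp (μ.re * s) * (C * Real.exp (-β * s)) := by
            gcongr; exact hf s hs.1
        _ = C * (Real.exp (μ.re * s) * Real.exp (-β * s)) := by ring
        _ = C * Real.exp (κ * s) := by rw [← Real.exp_add, hκ]; ring_nf)
    (right_mem_Icc.2 ht)
  rw [norm_mul, hexp] at key
  have ht1 : 1 ≤ Real.exp (κ * t) := Real.one_le_exp (mul_nonneg hκ0.le ht)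
  have h2 : Real.exp (μ.re * t) * ‖u t‖ ≤ (‖u 0‖ + C / κ) * Real.exp (κ * t) := by
    refine key.trans ?_
    rw [add_mul]
    gcongr
    exact le_mul_of_one_le_right (norm_nonneg _) ht1
  have h3 : Real.exp (κ * t) = Real.exp (μ.re * t) * Real.exp (-β * t) := by
    rw [← Real.exp_add, hκ]; ring_nf
  rw [h3] at h2
  refine le_of_mul_le_mul_left (h2.trans_eq ?_) (Real.exp_pos (μ.re * t))
  ring

/-- The shift operator on sequences of functions. -/
def seqShift : Module.End ℂ (ℕ → ℝ → ℂ) := LinearMap.funLeft ℂ (ℝ → ℂ) Nat.succ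

lemma seqShift_pow_apply (k : ℕ) (U : ℕ → ℝ → ℂ) (n : ℕ) : (seqShift ^ k) U n = U (n + k) := by
  induction k generalizing n with
  | zero => simp
  | succ k ih =>
    rw [pow_succ', Module.End.mul_apply]
    change (seqShift ^ k) U (n + 1) = _
    rw [ih]
    congr 1
    omega

/-- If `U (n + 1) = -(U n)'` on `[0, ∞)`, all roots of `Q` have real part larger than `β`, and all
terms of `Q(S) U` with `S` the shift are `O(exp (-β t))`, then so are all terms of `U`. -/
lemma exists_exp_bound_of_aeval_seqShift {β : ℝ} (d : ℕ) (Q : Polynomial ℂ)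
    (hd : Q.natDegree = d) (hQ : Q ≠ 0) (hroots : ∀ z, Q.IsRoot z → β < z.re) (U : ℕ → ℝ → ℂ)
    (hU : ∀ n, ∀ t ∈ Ici (0 : ℝ), HasDerivWithinAt (U n) (-U (n + 1) t) (Ici 0) t)
    (hbound : ∀ n, ∃ C, ∀ t ∈ Ici (0 : ℝ),
      ‖Polynomial.aeval seqShift Q U n t‖ ≤ C * Real.exp (-β * t)) (n : ℕ) :
    ∃ C, ∀ t ∈ Ici (0 : ℝ), ‖U n t‖ ≤ C * Real.exp (-β * t) := by
  induction d generalizing Q U n with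
  | zero =>
    obtain ⟨c, rfl⟩ := Polynomial.natDegree_eq_zero.1 hd
    have hc : c ≠ 0 := by simpa using hQ
    obtain ⟨C, hC⟩ := hbound n
    refine ⟨‖c‖⁻¹ * C, fun t ht => ?_⟩
    have := hC t ht
    rw [Polynomial.aeval_C, Module.algebraMap_end_apply, Pi.smul_apply, Pi.smul_apply,
      smul_eq_mul, norm_mul] at this
    rw [mul_assoc, inv_mul_eq_div, le_div_iff₀' (norm_pos_iff.2 hc)]
    exact this
  | succ d ih =>
    obtain ⟨μ, hμ⟩ := IsAlgClosed.exists_root Q (by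
      rw [Polynomial.degree_eq_natDegree hQ, hd]; norm_cast)
    obtain ⟨R, hR⟩ := Polynomial.dvd_iff_isRoot.2 hμ
    have hR0 : R ≠ 0 := by rintro rfl; simp [hQ] at hR
    have hRd : R.natDegree = d := by
      rw [hR, Polynomial.natDegree_mul (Polynomial.X_sub_C_ne_zero μ) hR0,
        Polynomial.natDegree_X_sub_C] at hd
      omega
    set W : ℕ → ℝ → ℂ := fun n t => U (n + 1) t - μ * U n t with hW
    have hWU : Polynomial.aeval seqShift (Polynomial.X - Polynomial.C μ) U = W := by
      ext n t
      simp only [map_sub, Polynomial.aeval_X, Polynomial.aeval_C, LinearMap.sub_apply,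
        Module.algebraMap_end_apply]
      rfl
    have hWb := ih R hRd hR0 (fun z hz => hroots z (by
        rw [hR, Polynomial.IsRoot, Polynomial.eval_mul, hz.eq_zero, mul_zero])) W
      (fun n t ht => by
        refine ((hU (n + 1) t ht).sub ((hU n t ht).const_mul μ)).congr_deriv ?_
        simp only [hW]; ring)
      (fun n => by
        rw [← hWU, ← Module.End.mul_apply, ← map_mul, mul_comm, ← hR]
        exact hbound n) n
    obtain ⟨C, hC⟩ := hWb
    refine exists_exp_bound_of_hasDerivWithinAt (hroots μ hμ) (f := W n) (fun t ht => ?_) hC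
    refine (hU n t ht).congr_deriv ?_
    simp only [hW]; ring

lemma exp_neg_mul_le_of_sub_le {β s t : ℝ} (h1 : t - 1 ≤ s) (h2 : s ≤ t) :
    Real.exp (-β * s) ≤ Real.exp |β| * Real.exp (-β * t) := by
  rw [← Real.exp_add, Real.exp_le_exp]
  have h3 : β * (t - s) ≤ |β| * (t - s) :=
    mul_le_mul_of_nonneg_right (le_abs_self β) (sub_nonneg.2 h2)
  have h4 : |β| * (t - s) ≤ |β| * 1 := mul_le_mul_of_nonneg_left (by linarith) (abs_nonneg β)
  linarith

section Semigroup

variable {X : Type*} [NormedAddCommGroup X] [NormedSpace ℝ X] {T : ℝ → X →L[ℝ] X}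

lemma norm_smul_apply_le_of_exp_bound {ω M β C : ℝ}
    (hbound : ∀ t : ℝ, 0 ≤ t → ‖T t‖ ≤ M * Real.exp (ω * t)) {w t : ℝ} (ht : 0 ≤ t)
    (hw : |w| ≤ C * Real.exp (-β * t)) (x : X) :
    ‖w • T t x‖ ≤ C * M * Real.exp (-(β - ω) * t) * ‖x‖ := by
  rw [norm_smul, Real.norm_eq_abs]
  calc |w| * ‖T t x‖ ≤ (C * Real.exp (-β * t)) * (M * Real.exp (ω * t) * ‖x‖) :=
        mul_le_mul hw ((T t).le_of_opNorm_le (hbound t ht) x) (norm_nonneg _)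
          ((abs_nonneg _).trans hw)
    _ = C * M * (Real.exp (-β * t) * Real.exp (ω * t)) * ‖x‖ := by ring
    _ = _ := by rw [← Real.exp_add]; ring_nf

lemma IsSCSemigroup.integrableOn_smul (hT : IsSCSemigroup T) {ω M β C : ℝ} (hβ : ω < β)
    (hbound : ∀ t : ℝ, 0 ≤ t → ‖T t‖ ≤ M * Real.exp (ω * t)) {w : ℝ → ℝ}
    (hwc : ContinuousOn w (Ici 0)) (hw : ∀ t ∈ Ici (0 : ℝ), |w t| ≤ C * Real.exp (-β * t))
    (x : X) : IntegrableOn (fun t => w t • T t x) (Ioi 0) := by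
  refine Integrable.mono'
    (((exp_neg_integrableOn_Ioi 0 (sub_pos.2 hβ)).const_mul (C * M)).mul_const ‖x‖)
    (((hwc.smul (hT.2.2 x)).mono Ioi_subset_Ici_self).aestronglyMeasurable measurableSet_Ioi) ?_
  filter_upwards [ae_restrict_mem measurableSet_Ioi] with t ht
  exact norm_smul_apply_le_of_exp_bound hbound (le_of_lt ht) (hw t (mem_Ici_of_Ioi ht)) x

lemma IsSCSemigroup.integrableOn_norm_mul (hT : IsSCSemigroup T) {ω M β C : ℝ} (hβ : ω < β)
    (hbound : ∀ t : ℝ, 0 ≤ t → ‖T t‖ ≤ M * Real.exp (ω * t)) {w : ℝ → ℝ}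
    (hwc : ContinuousOn w (Ici 0)) (hw : ∀ t ∈ Ici (0 : ℝ), |w t| ≤ C * Real.exp (-β * t)) :
    IntegrableOn (fun t => ‖T t‖ * |w t|) (Ioi 0) := by
  have hmeas : Measurable fun t => ‖T (max t 0)‖ := by
    refine LowerSemicontinuous.measurable fun t r hr => ?_
    obtain ⟨x, hx, hrx⟩ := (T (max t 0)).exists_lt_apply_of_lt_opNorm hr
    have hc : Continuous fun t => ‖T (max t 0) x‖ :=
      ((hT.2.2 x).comp_continuous (continuous_id.max continuous_const)
        (fun t => mem_Ici.2 (le_max_right _ _))).norm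
    filter_upwards [hc.continuousAt.eventually_const_lt hrx] with s hs
    refine hs.trans_le (((T (max s 0)).le_opNorm x).trans ?_)
    exact mul_le_of_le_one_right (norm_nonneg _) hx.le
  have hmeas' : AEStronglyMeasurable (fun t => ‖T t‖) (volume.restrict (Ioi 0)) := by
    refine hmeas.aestronglyMeasurable.congr ?_
    filter_upwards [ae_restrict_mem measurableSet_Ioi] with t ht
    rw [max_eq_left (le_of_lt ht)]
  refine Integrable.mono' ((exp_neg_integrableOn_Ioi 0 (sub_pos.2 hβ)).const_mul (C * M))
    (hmeas'.mul ((hwc.abs.mono Ioi_subset_Ici_self).aestronglyMeasurable measurableSet_Ioi)) ?_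
  filter_upwards [ae_restrict_mem measurableSet_Ioi] with t ht
  have ht' : 0 ≤ t := le_of_lt ht
  rw [Real.norm_of_nonneg (by positivity)]
  calc ‖T t‖ * |w t| ≤ (M * Real.exp (ω * t)) * (C * Real.exp (-β * t)) :=
        mul_le_mul (hbound t ht') (hw t ht') (abs_nonneg _) ((norm_nonneg _).trans (hbound t ht'))
    _ = C * M * (Real.exp (-β * t) * Real.exp (ω * t)) := by ring
    _ = _ := by rw [← Real.exp_add]; ring_nf

lemma IsSCSemigroup.apply_integral_smul [CompleteSpace X] (hT : IsSCSemigroup T) {w : ℝ → ℝ}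
    (x : X) (hint : IntegrableOn (fun t => w t • T t x) (Ioi 0)) {h : ℝ} (hh : 0 ≤ h) :
    T h (∫ t in Ioi (0 : ℝ), w t • T t x) = ∫ t in Ioi (0 : ℝ), w t • T (t + h) x := by
  rw [← ContinuousLinearMap.integral_comp_comm _ hint]
  refine setIntegral_congr_fun measurableSet_Ioi fun t ht => ?_
  simp only [map_smul]
  rw [add_comm, hT.2.1 t h (le_of_lt ht) hh]
  rfl

lemma IsSCSemigroup.tendsto_slope_integral_smul [CompleteSpace X] (hT : IsSCSemigroup T)
    {ω M β C C' : ℝ} (hβ : ω < β)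
    (hbound : ∀ t : ℝ, 0 ≤ t → ‖T t‖ ≤ M * Real.exp (ω * t)) {w v : ℝ → ℝ}
    (hw : ∀ t ∈ Ici (0 : ℝ), |w t| ≤ C * Real.exp (-β * t))
    (hv : ∀ t ∈ Ici (0 : ℝ), |v t| ≤ C' * Real.exp (-β * t))
    (hd : ∀ t ∈ Ici (0 : ℝ), HasDerivWithinAt w (-v t) (Ici 0) t) (x : X) :
    Tendsto (fun h : ℝ => (1 / h) • (T h (∫ t in Ioi (0 : ℝ), w t • T t x)
        - ∫ t in Ioi (0 : ℝ), w t • T t x)) (nhdsWithin 0 (Ioi 0))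
      (nhds ((∫ t in Ioi (0 : ℝ), v t • T t x) - w 0 • x)) := by
  have hwc : ContinuousOn w (Ici 0) := fun t ht => (hd t ht).continuousWithinAt
  have hC : 0 ≤ C := by simpa using (abs_nonneg _).trans (hw 0 self_mem_Ici)
  have hC' : 0 ≤ C' := by simpa using (abs_nonneg _).trans (hv 0 self_mem_Ici)
  set W : ℝ → ℝ := fun t => w (max t 0) with hW
  have hWc : Continuous W := hwc.comp_continuous (continuous_id.max continuous_const)
    (fun t => mem_Ici.2 (le_max_right _ _))
  have hWw : ∀ t, 0 ≤ t → W t = w t := fun t ht => by simp only [hW, max_eq_left ht]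
  have hint := hT.integrableOn_smul hβ hbound hwc hw x
  have hint' : ∀ h ∈ Ioc (0 : ℝ) 1, IntegrableOn (fun t => W (t - h) • T t x) (Ioi 0) := by
    intro h hh
    refine hT.integrableOn_smul (C := C * Real.exp |β|) hβ hbound
      (hWc.comp (continuous_sub_right h)).continuousOn (fun t ht => ?_) x
    refine (hw _ (mem_Ici.2 (le_max_right _ _))).trans ?_
    rw [mul_assoc]
    gcongr
    exact exp_neg_mul_le_of_sub_le (le_max_of_le_left (by linarith [hh.2]))
      (max_le (by linarith [hh.1]) ht)
  have hshift : ∀ h ∈ Ioc (0 : ℝ) 1, (1 / h) • (T h (∫ t in Ioi (0 : ℝ), w t • T t x)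
        - ∫ t in Ioi (0 : ℝ), w t • T t x)
      = (∫ t in Ioi (0 : ℝ), ((1 / h) * (W (t - h) - w t)) • T t x)
        - w 0 • ((1 / h) • ∫ t in (0 : ℝ)..h, T t x) := by
    intro h hh
    have e1 : T h (∫ t in Ioi (0 : ℝ), w t • T t x) = ∫ t in Ioi h, W (t - h) • T t x := by
      rw [hT.apply_integral_smul x hint hh.1.le]
      have := (measurePreserving_add_right (volume : Measure ℝ) h).setIntegral_preimage_emb
        (measurableEmbedding_addRight h) (fun t => W (t - h) • T t x) (Ioi h)
      rw [← this]
      have hpre : (fun t : ℝ => t + h) ⁻¹' Ioi h = Ioi 0 := by ext t; simp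
      rw [hpre]
      refine setIntegral_congr_fun measurableSet_Ioi fun t ht => ?_
      simp only [add_sub_cancel_right]
      rw [hWw t (le_of_lt ht)]
    have e2 := intervalIntegral.integral_interval_add_Ioi (hint' h hh)
      ((hint' h hh).mono_set (Ioi_subset_Ioi hh.1.le))
    have e3 : (∫ t in (0 : ℝ)..h, W (t - h) • T t x) = w 0 • ∫ t in (0 : ℝ)..h, T t x := by
      rw [← intervalIntegral.integral_smul]
      refine intervalIntegral.integral_congr fun t ht => ?_
      rw [uIcc_of_le hh.1.le] at ht
      simp only [hW]
      rw [max_eq_right (by linarith [ht.2])]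
    have e4 : (∫ t in Ioi (0 : ℝ), ((1 / h) * (W (t - h) - w t)) • T t x)
        = (1 / h) • ((∫ t in Ioi (0 : ℝ), W (t - h) • T t x)
          - ∫ t in Ioi (0 : ℝ), w t • T t x) := by
      rw [← integral_sub (hint' h hh) hint, ← integral_smul]
      simp only [mul_smul, sub_smul]
    rw [e1, e4, ← e2, e3, smul_comm (w 0), ← smul_sub]
    congr 1
    abel
  have hsmall : ∀ᶠ h in nhdsWithin (0 : ℝ) (Ioi 0), h ∈ Ioc (0 : ℝ) 1 :=
    Ioc_mem_nhdsGT one_pos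
  refine Tendsto.congr' (hsmall.mono fun h hh => (hshift h hh).symm) ?_
  refine Tendsto.sub ?_ ?_
  · refine tendsto_integral_filter_of_dominated_convergence
      (fun t => C' * Real.exp |β| * M * Real.exp (-(β - ω) * t) * ‖x‖) ?_ ?_ ?_ ?_
    · filter_upwards with h
      have h1 : ContinuousOn (fun t => ((1 / h) * (W (t - h) - w t)) • T t x) (Ici 0) :=
        (continuousOn_const.mul ((hWc.comp (continuous_sub_right h)).continuousOn.sub
          hwc)).smul (hT.2.2 x)
      exact (h1.mono Ioi_subset_Ici_self).aestronglyMeasurable measurableSet_Ioi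
    · filter_upwards [hsmall] with h hh
      filter_upwards [ae_restrict_mem measurableSet_Ioi] with t ht
      have ht' : 0 ≤ t := le_of_lt ht
      refine norm_smul_apply_le_of_exp_bound hbound ht' ?_ x
      have hs : max (t - h) 0 ≤ t := max_le (by linarith [hh.1]) ht'
      have hs' : t - h ≤ max (t - h) 0 := le_max_left _ _
      have hmv := (convex_Icc (max (t - h) 0) t).norm_image_sub_le_of_norm_hasDerivWithin_le
        (f := w) (f' := fun s => -v s) (C := C' * Real.exp |β| * Real.exp (-β * t))
        (fun s hs => (hd s ((le_max_right _ _).trans hs.1)).mono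
          (fun r hr => (le_max_right _ _).trans hr.1))
        (fun s hs => by
          rw [norm_neg, Real.norm_eq_abs, mul_assoc]
          refine (hv s ((le_max_right _ _).trans hs.1)).trans ?_
          gcongr
          exact exp_neg_mul_le_of_sub_le (by linarith [hs.1, hh.2]) hs.2)
        (right_mem_Icc.2 hs) (left_mem_Icc.2 hs)
      rw [abs_mul, abs_of_pos (one_div_pos.2 hh.1), one_div, inv_mul_eq_div, div_le_iff₀ hh.1]
      refine hmv.trans ?_
      gcongr
      rw [Real.norm_eq_abs, abs_sub_comm, abs_of_nonneg (by linarith)]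
      linarith
    · exact ((exp_neg_integrableOn_Ioi 0 (sub_pos.2 hβ)).const_mul _).mul_const _
    · filter_upwards [ae_restrict_mem measurableSet_Ioi] with t ht
      refine Tendsto.smul_const ?_ _
      have h1 : HasDerivAt W (-v t) t := by
        refine ((hd t (mem_Ici_of_Ioi ht)).hasDerivAt (Ici_mem_nhds ht)).congr_of_eventuallyEq ?_
        filter_upwards [Ioi_mem_nhds ht] with s hs using hWw s (le_of_lt hs)
      have h2 : HasDerivAt (fun h => W (t - h)) (v t) 0 := by
        have h3 : HasDerivAt W (-v t) (t - 0) := by rwa [sub_zero]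
        have := h3.comp_const_sub t 0
        simpa using this
      have h4 := h2.tendsto_slope_zero_right
      refine h4.congr fun h => ?_
      simp only [zero_add, sub_zero, smul_eq_mul, one_div, hWw t (le_of_lt ht)]
  · refine Tendsto.const_smul ?_ _
    have hc : Continuous fun t => T (max t 0) x :=
      (hT.2.2 x).comp_continuous (continuous_id.max continuous_const) (fun t => mem_Ici.2 (le_max_right _ _))
    have h1 := (intervalIntegral.integral_hasDerivAt_right (hc.intervalIntegrable 0 0)
      (hc.stronglyMeasurableAtFilter _ _) hc.continuousAt).tendsto_slope_zero_right
    simp only [max_self, hT.1, one_apply_eq_self] at h1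
    refine h1.congr' ?_
    filter_upwards [self_mem_nhdsWithin] with h hh
    rw [zero_add, intervalIntegral.integral_same, sub_zero, one_div]
    congr 1
    refine intervalIntegral.integral_congr fun t ht => ?_
    rw [uIcc_of_le (le_of_lt hh)] at ht
    simp only [max_eq_left ht.1]

/-- A continuous operator commuting with the semigroup commutes with its generator. -/
lemma IsGenerator.apply_eq_of_commute {A : X → X} (hA : IsGenerator T A) (Q : X →L[ℝ] X)
    (hQ : ∀ h : ℝ, 0 ≤ h → ∀ x, T h (Q x) = Q (T h x)) {x : X} (hx : x ∈ genDomain T) :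
    Q x ∈ genDomain T ∧ A (Q x) = Q (A x) := by
  have h1 : Tendsto (fun h : ℝ => (1 / h) • (T h (Q x) - Q x)) (nhdsWithin 0 (Ioi 0))
      (nhds (Q (A x))) := by
    refine ((Q.continuous.tendsto _).comp (hA x hx)).congr' ?_
    filter_upwards [self_mem_nhdsWithin] with h hh
    simp only [Function.comp_apply, map_smul, map_sub, hQ h (le_of_lt hh)]
  have h2 : Q x ∈ genDomain T := ⟨_, h1⟩
  exact ⟨h2, tendsto_nhds_unique (hA _ h2) h1⟩

lemma IsGenerator.iterate_apply_eq_of_commute {A : X → X} (hA : IsGenerator T A) (Q : X →L[ℝ] X)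
    (hQ : ∀ h : ℝ, 0 ≤ h → ∀ x, T h (Q x) = Q (T h x)) {k : ℕ} {x : X}
    (hx : x ∈ iterDomain T A k) : A^[k] (Q x) = Q (A^[k] x) := by
  induction k with
  | zero => rfl
  | succ k ih =>
    rw [Function.iterate_succ_apply', Function.iterate_succ_apply', ih hx.1]
    exact (hA.apply_eq_of_commute Q hQ hx.2).2

lemma iterDomain_anti {A : X → X} : Antitone (iterDomain T A) :=
  antitone_nat_of_succ_le fun _ _ hx => hx.1

end Semigroup

/-- If `H (n + 1) = -(H n)'` and `∑ k, P.coeff k * H k = 0` on `[0, ∞)`, then every `H n` decays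
exponentially at each rate `β` below the real parts of the roots of `P`. -/
lemma exists_exp_bound_of_ode {β : ℝ} {P : Polynomial ℝ} (hP : P ≠ 0)
    (hroots : ∀ z : ℂ, Polynomial.aeval z P = 0 → β < z.re) {H : ℕ → ℝ → ℝ}
    (hH : ∀ n, ∀ t ∈ Ici (0 : ℝ), HasDerivWithinAt (H n) (-H (n + 1) t) (Ici 0) t)
    {N : ℕ} (hN : P.natDegree < N)
    (hODE : ∀ t ∈ Ici (0 : ℝ), ∑ k ∈ Finset.range N, P.coeff k * H k t = 0) (n : ℕ) :
    ∃ C, ∀ t ∈ Ici (0 : ℝ), |H n t| ≤ C * Real.exp (-β * t) := by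
  have hODE' : ∀ n, ∀ t ∈ Ici (0 : ℝ), ∑ k ∈ Finset.range N, P.coeff k * H (n + k) t = 0 := by
    intro n
    induction n with
    | zero => simpa using hODE
    | succ n ih =>
      intro t ht
      have h1 : HasDerivWithinAt (fun t => ∑ k ∈ Finset.range N, P.coeff k * H (n + k) t)
          (∑ k ∈ Finset.range N, P.coeff k * -H (n + k + 1) t) (Ici 0) t :=
        HasDerivWithinAt.fun_sum fun k _ => (hH (n + k) t ht).const_mul _
      have h2 : HasDerivWithinAt (fun t => ∑ k ∈ Finset.range N, P.coeff k * H (n + k) t)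
          0 (Ici 0) t := (hasDerivWithinAt_const t (Ici 0) 0).congr ih (ih t ht)
      have h3 := (uniqueDiffOn_Ici (0 : ℝ) t ht).eq_deriv _ h1 h2
      simp only [mul_neg, Finset.sum_neg_distrib, neg_eq_zero] at h3
      rw [← h3]
      refine Finset.sum_congr rfl fun k _ => ?_
      rw [add_right_comm]
  have hinj : Function.Injective (algebraMap ℝ ℂ) := (algebraMap ℝ ℂ).injective
  obtain ⟨C, hC⟩ := exists_exp_bound_of_aeval_seqShift (β := β) _ (P.map (algebraMap ℝ ℂ)) rfl
    ((Polynomial.map_ne_zero_iff hinj).2 hP)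
    (fun z hz => hroots z (by rwa [Polynomial.IsRoot, Polynomial.eval_map_algebraMap] at hz))
    (fun n t => (H n t : ℂ))
    (fun n t ht => by
      have := (hH n t ht).ofReal_comp
      simpa using this)
    (fun n => ⟨0, fun t ht => by
      rw [Polynomial.aeval_eq_sum_range' (n := N) (by rwa [Polynomial.natDegree_map])]
      simp only [LinearMap.sum_apply, LinearMap.smul_apply, Finset.sum_apply, Pi.smul_apply,
        seqShift_pow_apply, Polynomial.coeff_map, smul_eq_mul, Complex.coe_algebraMap]
      have := hODE' n t ht
      rw [zero_mul, norm_le_zero_iff]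
      exact_mod_cast this⟩) n
  exact ⟨C, fun t ht => by simpa using hC t ht⟩

theorem stmt_0 {X : Type*} [NormedAddCommGroup X] [NormedSpace ℝ X] [CompleteSpace X]
    (T : ℝ → X →L[ℝ] X) (hT : IsSCSemigroup T) (A : X → X) (hA : IsGenerator T A)
    (ω M : ℝ) (hM : 0 ≤ M) (hbound : ∀ t : ℝ, 0 ≤ t → ‖T t‖ ≤ M * Real.exp (ω * t))
    (m : ℕ) (P : Polynomial ℝ) (hdeg : P.natDegree = m + 2)
    (hroots : ∀ z : ℂ, Polynomial.aeval z P = 0 → ω < z.re)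
    (g : ℝ → ℝ) (hg : ContDiffOn ℝ (⊤ : ℕ∞) g (Set.Ici 0))
    (hODE : ∀ t ∈ Set.Ici (0 : ℝ),
      ∑ k ∈ Finset.range (m + 3),
        (-1 : ℝ) ^ k * P.coeff k * iteratedDerivWithin k g (Set.Ici 0) t = 0)
    (hInit : ∀ k ≤ m, iteratedDerivWithin k g (Set.Ici 0) 0 = 0)
    (hInitTop : iteratedDerivWithin (m + 1) g (Set.Ici 0) 0 = (-1 : ℝ) ^ m * (P.coeff (m + 2))⁻¹) :
    IntegrableOn (fun t => ‖T t‖ * |g t|) (Set.Ioi 0) ∧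
    Set.BijOn (fun x => ∑ k ∈ Finset.range (m + 3), P.coeff k • A^[k] x)
      (iterDomain T A (m + 2)) Set.univ ∧
    ∃ Q : X →L[ℝ] X,
      (∀ x ∈ iterDomain T A (m + 2),
        Q (∑ k ∈ Finset.range (m + 3), P.coeff k • A^[k] x) = x) ∧
      (∀ x : X, Q x ∈ iterDomain T A (m + 2) ∧
        ∑ k ∈ Finset.range (m + 3), P.coeff k • A^[k] (Q x) = x) ∧
      ∀ x : X, Q x = ∫ t in Set.Ioi (0 : ℝ), g t • T t x := by
  have hP : P ≠ 0 := by rintro rfl; simp at hdeg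
  have hlead : P.coeff (m + 2) ≠ 0 := by
    rw [← hdeg]; exact Polynomial.leadingCoeff_ne_zero.2 hP
  obtain ⟨β, hωβ, hβ⟩ : ∃ β, ω < β ∧ ∀ z : ℂ, Polynomial.aeval z P = 0 → β < z.re := by
    have h1 : ∀ᶠ β in nhdsWithin ω (Ioi ω), ∀ z ∈ (P.aroots ℂ).toFinset, β < z.re :=
      (eventually_all_finset _).2 fun z hz => mem_nhdsWithin_of_mem_nhds
        (Iio_mem_nhds (hroots z (Polynomial.mem_aroots.1 (Multiset.mem_toFinset.1 hz)).2))
    obtain ⟨β, h2, h3⟩ := (h1.and self_mem_nhdsWithin).exists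
    exact ⟨β, h3, fun z hz => h2 z (Multiset.mem_toFinset.2 (Polynomial.mem_aroots.2 ⟨hP, hz⟩))⟩
  set H : ℕ → ℝ → ℝ := fun k t => (-1) ^ k * iteratedDerivWithin k g (Ici 0) t with hHdef
  have hH0 : H 0 = g := by ext t; simp [hHdef]
  have hH : ∀ n, ∀ t ∈ Ici (0 : ℝ), HasDerivWithinAt (H n) (-H (n + 1) t) (Ici 0) t := by
    intro n t ht
    have h1 := (hg.differentiableOn_iteratedDerivWithin (m := n)
      (by exact_mod_cast WithTop.coe_lt_top _) (uniqueDiffOn_Ici 0)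
      t ht).hasDerivWithinAt.const_mul ((-1 : ℝ) ^ n)
    refine h1.congr_deriv ?_
    simp only [hHdef, iteratedDerivWithin_succ, pow_succ]
    ring
  have hHc : ∀ n, ContinuousOn (H n) (Ici 0) := fun n t ht => (hH n t ht).continuousWithinAt
  have hHode : ∀ t ∈ Ici (0 : ℝ), ∑ k ∈ Finset.range (m + 3), P.coeff k * H k t = 0 := by
    intro t ht
    rw [← hODE t ht]
    refine Finset.sum_congr rfl fun k _ => ?_
    simp only [hHdef]; ring
  have hHb := exists_exp_bound_of_ode hP hβ hH (by omega : P.natDegree < m + 3) hHode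
  choose C hC using hHb
  have hHzero : ∀ k ≤ m, H k 0 = 0 := fun k hk => by simp only [hHdef, hInit k hk, mul_zero]
  have hHtop : P.coeff (m + 2) * -H (m + 1) 0 = 1 := by
    simp only [hHdef, hInitTop, pow_succ]
    rw [show (-1 : ℝ) ^ m * -1 * ((-1) ^ m * (P.coeff (m + 2))⁻¹)
      = -(((-1) ^ m * (-1) ^ m) * (P.coeff (m + 2))⁻¹) by ring, ← mul_pow]
    simp [hlead]
  have hint : ∀ k x, IntegrableOn (fun t => H k t • T t x) (Ioi 0) :=
    fun k x => hT.integrableOn_smul hωβ hbound (hHc k) (hC k) x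
  set R : ℕ → X → X := fun k x => ∫ t in Ioi (0 : ℝ), H k t • T t x with hR
  have hgen : ∀ k x, R k x ∈ genDomain T ∧ A (R k x) = R (k + 1) x - H k 0 • x := by
    intro k x
    have h1 := hT.tendsto_slope_integral_smul hωβ hbound (hC k) (hC (k + 1)) (hH k) x
    have h2 : R k x ∈ genDomain T := ⟨_, h1⟩
    exact ⟨h2, tendsto_nhds_unique (hA _ h2) h1⟩
  have hpow : ∀ x, ∀ k ≤ m + 1, R 0 x ∈ iterDomain T A k ∧ A^[k] (R 0 x) = R k x := by
    intro x k
    induction k with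
    | zero => exact fun _ => ⟨mem_univ _, rfl⟩
    | succ k ih =>
      intro hk
      obtain ⟨h1, h2⟩ := ih (by omega)
      refine ⟨⟨h1, h2 ▸ (hgen k x).1⟩, ?_⟩
      rw [Function.iterate_succ_apply', h2, (hgen k x).2, hHzero k (by omega), zero_smul, sub_zero]
  have hdom : ∀ x, R 0 x ∈ iterDomain T A (m + 2) := fun x =>
    ⟨(hpow x _ le_rfl).1, (hpow x _ le_rfl).2 ▸ (hgen (m + 1) x).1⟩
  have hright : ∀ x, ∑ k ∈ Finset.range (m + 3), P.coeff k • A^[k] (R 0 x) = x := by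
    intro x
    have h1 : ∑ k ∈ Finset.range (m + 3), P.coeff k • R k x = 0 := by
      simp only [hR, ← integral_smul]
      rw [← integral_finsetSum (f := fun k t => P.coeff k • H k t • T t x) _
        fun k _ => (hint k x).smul (P.coeff k)]
      rw [setIntegral_congr_fun (g := fun _ => (0 : X)) measurableSet_Ioi, integral_zero]
      intro t ht
      simp only [smul_smul, ← Finset.sum_smul, hHode t (mem_Ici_of_Ioi ht), zero_smul]
    rw [Finset.sum_range_succ] at h1 ⊢
    rw [Finset.sum_congr rfl fun k hk => by
      rw [(hpow x k (by have := Finset.mem_range.1 hk; omega)).2],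
      Function.iterate_succ_apply', (hpow x _ le_rfl).2, (hgen (m + 1) x).2, sub_eq_add_neg,
      smul_add, ← add_assoc, h1, zero_add, ← neg_smul, smul_smul, hHtop, one_smul]
  let L : X →ₗ[ℝ] X :=
    { toFun := R 0
      map_add' := fun x y => by
        simp only [hR, map_add, smul_add]
        exact integral_add (hint 0 x) (hint 0 y)
      map_smul' := fun c x => by
        simp only [hR, map_smul, smul_comm _ c, RingHom.id_apply]
        exact integral_smul _ _ }
  let Q : X →L[ℝ] X := L.mkContinuousOfExistsBound
    ⟨∫ t in Ioi (0 : ℝ), C 0 * M * Real.exp (-(β - ω) * t), fun x => by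
      rw [← integral_mul_const]
      refine norm_integral_le_of_norm_le
        (((exp_neg_integrableOn_Ioi 0 (sub_pos.2 hωβ)).const_mul _).mul_const _) ?_
      filter_upwards [ae_restrict_mem measurableSet_Ioi] with t ht
      exact norm_smul_apply_le_of_exp_bound hbound (le_of_lt ht) (hC 0 t (mem_Ici_of_Ioi ht)) x⟩
  have hQR : ∀ x, Q x = R 0 x := fun _ => rfl
  have hcomm : ∀ h : ℝ, 0 ≤ h → ∀ x, T h (Q x) = Q (T h x) := by
    intro h hh x
    rw [hQR, hQR]
    simp only [hR]
    rw [hT.apply_integral_smul x (hint 0 x) hh]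
    refine setIntegral_congr_fun measurableSet_Ioi fun t ht => ?_
    simp only [hT.2.1 h t hh (le_of_lt ht), ContinuousLinearMap.comp_apply]
  have hleft : ∀ x ∈ iterDomain T A (m + 2),
      Q (∑ k ∈ Finset.range (m + 3), P.coeff k • A^[k] x) = x := by
    intro x hx
    rw [map_sum]
    refine (Finset.sum_congr rfl fun k hk => ?_).trans (hright x)
    have hk' : k ≤ m + 2 := by have := Finset.mem_range.1 hk; omega
    rw [map_smul, ← hA.iterate_apply_eq_of_commute Q hcomm (iterDomain_anti hk' hx), hQR]
  refine ⟨?_, ⟨fun _ _ => mem_univ _, fun x hx y hy hxy => ?_, fun x _ => ?_⟩,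
    Q, hleft, fun x => ⟨hdom x, hright x⟩, fun x => ?_⟩
  · rw [← hH0]
    exact hT.integrableOn_norm_mul hωβ hbound (hHc 0) (hC 0)
  · rw [← hleft x hx, ← hleft y hy]
    exact congrArg Q hxy
  · exact ⟨R 0 x, hdom x, hright x⟩
  · rw [hQR, ← hH0]
end
end

section
/- Let X be a real Banach space, let T : [0,∞) → B(X) be a strongly continuous semigroup with generator A, and let ω ∈ ℝ, M ≥ 0 satisfy ‖T(t)‖ ≤ M e^{ωt} for all t ≥ 0. Let a, b ∈ ℝ with a > ω. Then the operator Δ := A² − 2a A + (a² + b²)·Id with domain D(A²) is a bijection from D(A²) onto X, its inverse Q is a bounded linear operator on X, and Q x = ∫_0^∞ t e^{−a t} sinc(b t) · T(t)x dt (Bochner integral) for every x ∈ X. -/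
open MeasureTheory Filter Set Quaternion

noncomputable section

/-- `y` is the right derivative at `0` of the orbit of `x`, that is, `x ∈ D(A)` and `A x = y`. -/
def HasGen {X : Type*} [NormedAddCommGroup X] [NormedSpace ℝ X]
    (T : ℝ → X →L[ℝ] X) (x y : X) : Prop :=
  Tendsto (fun h : ℝ => (1 / h) • (T h x - x)) (nhdsWithin 0 (Set.Ioi 0)) (nhds y)

/-- `f` is bounded by a multiple of `exp (-c t)` on `[0,∞)`. -/
def ExpDecay (c : ℝ) (f : ℝ → ℝ) : Prop :=
  ∃ C : ℝ, ∀ t : ℝ, 0 ≤ t → |f t| ≤ C * Real.exp (-(c * t))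

namespace ExpDecay

variable {c : ℝ} {f g : ℝ → ℝ}

lemma add (hf : ExpDecay c f) (hg : ExpDecay c g) : ExpDecay c (fun t => f t + g t) := by
  obtain ⟨C, hC⟩ := hf
  obtain ⟨D, hD⟩ := hg
  refine ⟨C + D, fun t ht => (abs_add_le _ _).trans ?_⟩
  linarith [hC t ht, hD t ht]

lemma const_mul (hf : ExpDecay c f) (r : ℝ) : ExpDecay c (fun t => r * f t) := by
  obtain ⟨C, hC⟩ := hf
  refine ⟨|r| * C, fun t ht => ?_⟩
  rw [abs_mul, mul_assoc]
  exact mul_le_mul_of_nonneg_left (hC t ht) (abs_nonneg r)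

end ExpDecay

section Semigroup

variable {X : Type*} [NormedAddCommGroup X] [NormedSpace ℝ X] {T : ℝ → X →L[ℝ] X}
  {A : X → X} {x y x' y' : X}

lemma HasGen.mem_genDomain (h : HasGen T x y) : x ∈ genDomain T := ⟨y, h⟩

lemma IsGenerator.eq_of_hasGen (hA : IsGenerator T A) (h : HasGen T x y) : A x = y :=
  tendsto_nhds_unique (hA x h.mem_genDomain) h

lemma HasGen.const_smul_sub (h : HasGen T x y) (h' : HasGen T x' y') (r : ℝ) :
    HasGen T (r • x - x') (r • y - y') := by
  refine ((Tendsto.const_smul h r).sub h').congr fun s => ?_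
  simp only [map_sub, map_smul]
  module

lemma HasGen.map (h : HasGen T x y) (S : X →L[ℝ] X)
    (hS : ∀ s : ℝ, 0 ≤ s → ∀ z, T s (S z) = S (T s z)) : HasGen T (S x) (S y) := by
  refine ((S.continuous.tendsto y).comp h).congr' ?_
  filter_upwards [self_mem_nhdsWithin] with s hs
  simp [hS s (le_of_lt hs)]

variable {ω M c : ℝ} {f f' : ℝ → ℝ}

lemma norm_semigroup_apply_le (hbound : ∀ t : ℝ, 0 ≤ t → ‖T t‖ ≤ M * Real.exp (ω * t))
    {t : ℝ} (ht : 0 ≤ t) (x : X) : ‖T t x‖ ≤ M * Real.exp (ω * t) * ‖x‖ :=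
  (T t).le_of_opNorm_le (hbound t ht) x

lemma integrableOn_exp_mul_exp (hc : ω < c) :
    IntegrableOn (fun t : ℝ => Real.exp (-(c * t)) * Real.exp (ω * t)) (Ioi 0) := by
  refine (exp_neg_integrableOn_Ioi 0 (sub_pos.2 hc)).congr_fun (fun t _ => ?_) measurableSet_Ioi
  simp only
  rw [← Real.exp_add]
  ring_nf

lemma continuousOn_smul_orbit (hT : IsSCSemigroup T) (hf : Continuous f) (x : X) :
    ContinuousOn (fun t => f t • T t x) (Ici 0) :=
  hf.continuousOn.smul (hT.2.2 x)

lemma ExpDecay.exists_norm_smul_orbit_le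
    (hbound : ∀ t : ℝ, 0 ≤ t → ‖T t‖ ≤ M * Real.exp (ω * t)) (hd : ExpDecay c f) :
    ∃ C : ℝ, ∀ t : ℝ, 0 ≤ t → ∀ x : X,
      ‖f t • T t x‖ ≤ C * (Real.exp (-(c * t)) * Real.exp (ω * t)) * ‖x‖ := by
  obtain ⟨C, hC⟩ := hd
  refine ⟨C * M, fun t ht x => ?_⟩
  rw [norm_smul, Real.norm_eq_abs]
  calc |f t| * ‖T t x‖
      ≤ (C * Real.exp (-(c * t))) * (M * Real.exp (ω * t) * ‖x‖) :=
        mul_le_mul (hC t ht) (norm_semigroup_apply_le hbound ht x) (norm_nonneg _)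
          ((abs_nonneg _).trans (hC t ht))
    _ = _ := by ring

lemma integrableOn_smul_orbit (hT : IsSCSemigroup T)
    (hbound : ∀ t : ℝ, 0 ≤ t → ‖T t‖ ≤ M * Real.exp (ω * t)) (hc : ω < c)
    (hf : Continuous f) (hd : ExpDecay c f) (x : X) :
    IntegrableOn (fun t => f t • T t x) (Ioi 0) := by
  obtain ⟨C, hC⟩ := hd.exists_norm_smul_orbit_le hbound
  refine Integrable.mono' (((integrableOn_exp_mul_exp hc).const_mul C).mul_const ‖x‖)
    (((continuousOn_smul_orbit hT hf x).mono Ioi_subset_Ici_self).aestronglyMeasurable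
      measurableSet_Ioi) ?_
  filter_upwards [ae_restrict_mem measurableSet_Ioi] with t ht
  exact hC t (le_of_lt ht) x

lemma exists_clm_eq_integral_smul_orbit (hT : IsSCSemigroup T)
    (hbound : ∀ t : ℝ, 0 ≤ t → ‖T t‖ ≤ M * Real.exp (ω * t)) (hc : ω < c)
    (hf : Continuous f) (hd : ExpDecay c f) :
    ∃ S : X →L[ℝ] X, ∀ x, S x = ∫ t in Ioi (0 : ℝ), f t • T t x := by
  have hint := integrableOn_smul_orbit hT hbound hc hf hd
  obtain ⟨C, hC⟩ := hd.exists_norm_smul_orbit_le hbound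
  refine ⟨LinearMap.mkContinuous
    { toFun := fun x => ∫ t in Ioi (0 : ℝ), f t • T t x
      map_add' := fun x y => ?_
      map_smul' := fun r x => ?_ }
    (∫ t in Ioi (0 : ℝ), C * (Real.exp (-(c * t)) * Real.exp (ω * t))) fun x => ?_, fun x => rfl⟩
  · rw [← integral_add (hint x) (hint y)]
    simp only [map_add, smul_add]
  · rw [RingHom.id_apply, ← integral_smul]
    simp only [map_smul, smul_comm r]
  · rw [← integral_mul_const]
    refine norm_integral_le_of_norm_le
      (((integrableOn_exp_mul_exp hc).const_mul C).mul_const ‖x‖) ?_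
    filter_upwards [ae_restrict_mem measurableSet_Ioi] with t ht
    exact hC t (le_of_lt ht) x

lemma integral_smul_orbit_apply (hT : IsSCSemigroup T) {s : ℝ} (hs : 0 ≤ s) (x : X) :
    ∫ t in Ioi (0 : ℝ), f t • T t (T s x) = ∫ t in Ioi (0 : ℝ), f t • T (t + s) x := by
  refine setIntegral_congr_fun measurableSet_Ioi fun t ht => ?_
  rw [hT.2.1 s t hs (le_of_lt ht), ContinuousLinearMap.comp_apply]

lemma integral_smul_orbit_eq_add (hT : IsSCSemigroup T)
    (hbound : ∀ t : ℝ, 0 ≤ t → ‖T t‖ ≤ M * Real.exp (ω * t)) (hc : ω < c)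
    (hf : Continuous f) (hd : ExpDecay c f) {s : ℝ} (hs : 0 ≤ s) (x : X) :
    ∫ t in Ioi (0 : ℝ), f t • T t x =
      (∫ t in (0 : ℝ)..s, f t • T t x) + ∫ t in Ioi (0 : ℝ), f (t + s) • T (t + s) x := by
  have hint := integrableOn_smul_orbit hT hbound hc hf hd x
  have h := (measurePreserving_add_right volume s).setIntegral_preimage_emb
    (measurableEmbedding_addRight s) (fun t => f t • T t x) (Ioi s)
  rw [preimage_add_const_Ioi, sub_self] at h
  rw [h, intervalIntegral.integral_of_le hs, ← setIntegral_union
    (Set.Ioc_disjoint_Ioi le_rfl) measurableSet_Ioi (hint.mono_set Ioc_subset_Ioi_self)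
    (hint.mono_set (Ioi_subset_Ioi hs)), Ioc_union_Ioi_eq_Ioi hs]

lemma abs_slope_le_of_expDecay (hf : ∀ t, HasDerivAt f (f' t) t) {C : ℝ}
    (hC : ∀ t, 0 ≤ t → |f' t| ≤ C * Real.exp (-(c * t))) {t h : ℝ} (ht : 0 ≤ t) (hh : 0 < h)
    (h1 : h ≤ 1) :
    |(1 / h) * (f t - f (t + h))| ≤ C * Real.exp |c| * Real.exp (-(c * t)) := by
  have hC0 : 0 ≤ C := by
    have := (abs_nonneg _).trans (hC 0 le_rfl)
    simpa using this
  have key := (convex_Icc t (t + h)).norm_image_sub_le_of_norm_hasDerivWithin_le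
    (f := f) (f' := f') (C := C * Real.exp |c| * Real.exp (-(c * t)))
    (fun u _ => (hf u).hasDerivWithinAt) (fun u hu => ?_)
    (left_mem_Icc.2 (by linarith)) (right_mem_Icc.2 (by linarith))
  · rw [add_sub_cancel_left, Real.norm_eq_abs, Real.norm_eq_abs, abs_of_pos hh] at key
    rw [abs_mul, abs_of_pos (one_div_pos.2 hh), abs_sub_comm, one_div, inv_mul_le_iff₀ hh]
    linarith
  · refine (hC u (ht.trans hu.1)).trans ?_
    rw [mul_assoc, ← Real.exp_add]
    refine mul_le_mul_of_nonneg_left (Real.exp_le_exp.2 ?_) hC0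
    have h2 : -(c * (u - t)) ≤ |c| := by
      calc -(c * (u - t)) ≤ |c * (u - t)| := neg_le_abs _
        _ = |c| * (u - t) := by rw [abs_mul, abs_of_nonneg (sub_nonneg.2 hu.1)]
        _ ≤ |c| * 1 := mul_le_mul_of_nonneg_left (by linarith [hu.2]) (abs_nonneg _)
        _ = |c| := mul_one _
    linarith

lemma tendsto_integral_slope_smul_orbit (hT : IsSCSemigroup T) (hM : 0 ≤ M)
    (hbound : ∀ t : ℝ, 0 ≤ t → ‖T t‖ ≤ M * Real.exp (ω * t)) (hc : ω < c)
    (hf : ∀ t, HasDerivAt f (f' t) t) (hd' : ExpDecay c f') (x : X) :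
    Tendsto (fun h : ℝ => ∫ t in Ioi (0 : ℝ), ((1 / h) * (f t - f (t + h))) • T (t + h) x)
      (nhdsWithin 0 (Ioi 0)) (nhds (∫ t in Ioi (0 : ℝ), (-f' t) • T t x)) := by
  have hcont : Continuous f := continuous_iff_continuousAt.2 fun t => (hf t).continuousAt
  obtain ⟨C, hC⟩ := hd'
  refine tendsto_integral_filter_of_dominated_convergence
    (fun t => C * Real.exp |c| * M * Real.exp |ω| * ‖x‖ *
      (Real.exp (-(c * t)) * Real.exp (ω * t))) ?_ ?_
    ((integrableOn_exp_mul_exp hc).const_mul _) ?_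
  · filter_upwards [self_mem_nhdsWithin] with h hh
    refine ContinuousOn.aestronglyMeasurable ?_ measurableSet_Ioi
    refine ContinuousOn.smul (by fun_prop) ?_
    exact (hT.2.2 x).comp (by fun_prop) fun t ht =>
      (add_pos (mem_Ioi.1 ht) (mem_Ioi.1 hh)).le
  · filter_upwards [Ioc_mem_nhdsGT (zero_lt_one' ℝ)] with h hh
    filter_upwards [ae_restrict_mem measurableSet_Ioi] with t ht
    have ht0 : 0 ≤ t := le_of_lt ht
    have h1 := abs_slope_le_of_expDecay hf hC ht0 hh.1 hh.2
    have h2 := norm_semigroup_apply_le hbound (add_nonneg ht0 hh.1.le) x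
    have h3 : Real.exp (ω * (t + h)) ≤ Real.exp |ω| * Real.exp (ω * t) := by
      rw [← Real.exp_add]
      refine Real.exp_le_exp.2 ?_
      nlinarith [le_abs_self ω, abs_nonneg ω, hh.1, hh.2]
    rw [norm_smul, Real.norm_eq_abs]
    calc |1 / h * (f t - f (t + h))| * ‖T (t + h) x‖
        ≤ (C * Real.exp |c| * Real.exp (-(c * t))) *
          (M * (Real.exp |ω| * Real.exp (ω * t)) * ‖x‖) :=
          mul_le_mul h1 (h2.trans (by gcongr)) (norm_nonneg _) ((abs_nonneg _).trans h1)
      _ = _ := by ring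
  · filter_upwards [ae_restrict_mem measurableSet_Ioi] with t ht
    have hslope : Tendsto (fun h : ℝ => (1 / h) * (f t - f (t + h)))
        (nhdsWithin 0 (Ioi 0)) (nhds (-f' t)) := by
      refine ((hf t).tendsto_slope_zero_right.neg).congr fun h => ?_
      simp only [smul_eq_mul]
      ring
    have horbit : Tendsto (fun h : ℝ => T (t + h) x) (nhdsWithin 0 (Ioi 0)) (nhds (T t x)) := by
      have hat : ContinuousAt (fun s => T s x) t :=
        (hT.2.2 x).continuousAt (Ici_mem_nhds ht)
      have hshift : Tendsto (fun h : ℝ => t + h) (nhdsWithin 0 (Ioi 0)) (nhds t) := by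
        have : Tendsto (fun h : ℝ => t + h) (nhds 0) (nhds (t + 0)) :=
          (continuous_const.add continuous_id).tendsto 0
        rw [add_zero] at this
        exact this.mono_left nhdsWithin_le_nhds
      exact hat.tendsto.comp hshift
    exact hslope.smul horbit

variable [CompleteSpace X]

lemma apply_integral_smul_orbit (hT : IsSCSemigroup T)
    (hbound : ∀ t : ℝ, 0 ≤ t → ‖T t‖ ≤ M * Real.exp (ω * t)) (hc : ω < c)
    (hf : Continuous f) (hd : ExpDecay c f) {s : ℝ} (hs : 0 ≤ s) (x : X) :
    T s (∫ t in Ioi (0 : ℝ), f t • T t x) = ∫ t in Ioi (0 : ℝ), f t • T (t + s) x := by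
  rw [← ContinuousLinearMap.integral_comp_comm _
    (integrableOn_smul_orbit hT hbound hc hf hd x)]
  refine setIntegral_congr_fun measurableSet_Ioi fun t ht => ?_
  rw [add_comm, hT.2.1 t s (le_of_lt ht) hs, map_smul, ContinuousLinearMap.comp_apply]

lemma tendsto_average_smul_orbit (hT : IsSCSemigroup T) (hf : Continuous f) (x : X) :
    Tendsto (fun h : ℝ => (1 / h) • ∫ t in (0 : ℝ)..h, f t • T t x)
      (nhdsWithin 0 (Ioi 0)) (nhds (f 0 • x)) := by
  have hcont := continuousOn_smul_orbit hT hf x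
  have hderiv : HasDerivWithinAt (fun h : ℝ => ∫ t in (0 : ℝ)..h, f t • T t x)
      (f 0 • T 0 x) (Ici 0) 0 :=
    intervalIntegral.integral_hasDerivWithinAt_right (by simp)
      ((hcont.mono Ioi_subset_Ici_self).stronglyMeasurableAtFilter_nhdsWithin measurableSet_Ioi 0)
      (hcont.continuousWithinAt self_mem_Ici |>.mono Ioi_subset_Ici_self)
  rw [← hasDerivWithinAt_Ioi_iff_Ici, hasDerivWithinAt_iff_tendsto_slope' self_notMem_Ioi,
    hT.1] at hderiv
  simpa [slope_fun_def] using hderiv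

lemma hasGen_integral_smul_orbit (hT : IsSCSemigroup T) (hM : 0 ≤ M)
    (hbound : ∀ t : ℝ, 0 ≤ t → ‖T t‖ ≤ M * Real.exp (ω * t)) (hc : ω < c)
    (hf : ∀ t, HasDerivAt f (f' t) t) (hd : ExpDecay c f) (hd' : ExpDecay c f') (x : X) :
    HasGen T (∫ t in Ioi (0 : ℝ), f t • T t x)
      ((∫ t in Ioi (0 : ℝ), (-f' t) • T t x) - f 0 • x) := by
  have hcont : Continuous f := continuous_iff_continuousAt.2 fun t => (hf t).continuousAt
  refine ((tendsto_integral_slope_smul_orbit hT hM hbound hc hf hd' x).sub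
    (tendsto_average_smul_orbit hT hcont x)).congr' ?_
  filter_upwards [self_mem_nhdsWithin] with h hh
  have hh0 : (0 : ℝ) ≤ h := le_of_lt hh
  have hshift : IntegrableOn (fun t => f (t + h) • T (t + h) x) (Ioi 0) := by
    have hint := integrableOn_smul_orbit hT hbound hc hcont hd x
    have h' := ((measurePreserving_add_right volume h).integrableOn_comp_preimage
      (measurableEmbedding_addRight h)).2 (hint.mono_set (Ioi_subset_Ioi hh0))
    rwa [preimage_add_const_Ioi, sub_self] at h'
  have horbit : IntegrableOn (fun t => f t • T (t + h) x) (Ioi 0) := by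
    refine (integrableOn_smul_orbit hT hbound hc hcont hd (T h x)).congr_fun
      (fun t ht => ?_) measurableSet_Ioi
    simp only
    rw [hT.2.1 h t hh0 (le_of_lt ht), ContinuousLinearMap.comp_apply]
  rw [apply_integral_smul_orbit hT hbound hc hcont hd hh0,
    integral_smul_orbit_eq_add hT hbound hc hcont hd hh0]
  simp_rw [mul_smul, sub_smul]
  rw [integral_smul, integral_sub horbit hshift]
  module

end Semigroup

section Kernel

variable (a b : ℝ)

lemma abs_sinc_le_one (r : ℝ) : |sinc r| ≤ 1 := by
  by_cases hr : r = 0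
  · simp [sinc, hr]
  · rw [sinc, if_neg hr, abs_div, div_le_one (abs_pos.2 hr)]
    exact Real.abs_sin_le_abs

lemma mul_sinc_mul (t : ℝ) : b * (t * sinc (b * t)) = Real.sin (b * t) := by
  by_cases h : b * t = 0
  · rw [← mul_assoc, h]
    simp
  · rw [sinc, if_neg h, ← mul_assoc, mul_div_cancel₀ _ h]

lemma hasDerivAt_exp_neg_mul (t : ℝ) :
    HasDerivAt (fun t => Real.exp (-(a * t))) (-a * Real.exp (-(a * t))) t := by
  simpa [mul_comm] using ((hasDerivAt_id' t).const_mul a).fun_neg.exp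

lemma hasDerivAt_mul_sinc (t : ℝ) :
    HasDerivAt (fun t => t * sinc (b * t)) (Real.cos (b * t)) t := by
  by_cases hb : b = 0
  · subst hb
    simpa [sinc] using hasDerivAt_id' t
  · have h := (((hasDerivAt_id' t).const_mul b).sin).div_const b
    rw [mul_one, mul_div_cancel_right₀ _ hb] at h
    refine h.congr_of_eventuallyEq (Eventually.of_forall fun s => ?_)
    simp only
    rw [← mul_sinc_mul, mul_div_cancel_left₀ _ hb]

lemma hasDerivAt_mul_exp_mul_sinc (t : ℝ) :
    HasDerivAt (fun t => t * Real.exp (-(a * t)) * sinc (b * t))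
      (-a * (t * Real.exp (-(a * t)) * sinc (b * t)) +
        1 * (Real.exp (-(a * t)) * Real.cos (b * t))) t := by
  have h := (hasDerivAt_exp_neg_mul a t).mul (hasDerivAt_mul_sinc b t)
  refine (h.congr_of_eventuallyEq (Eventually.of_forall fun s => ?_)).congr_deriv (by ring)
  simp only [Pi.mul_apply]
  ring

lemma hasDerivAt_exp_mul_cos (t : ℝ) :
    HasDerivAt (fun t => Real.exp (-(a * t)) * Real.cos (b * t))
      (-a * (Real.exp (-(a * t)) * Real.cos (b * t)) +
        -b ^ 2 * (t * Real.exp (-(a * t)) * sinc (b * t))) t := by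
  have h := (hasDerivAt_exp_neg_mul a t).mul (((hasDerivAt_id' t).const_mul b).cos)
  refine h.congr_deriv ?_
  rw [← mul_sinc_mul b t]
  ring

variable {a} {c : ℝ}

lemma expDecay_mul_exp_mul_sinc (hca : c < a) :
    ExpDecay c (fun t => t * Real.exp (-(a * t)) * sinc (b * t)) := by
  have hδ : 0 < a - c := sub_pos.2 hca
  refine ⟨1 / (a - c), fun t ht => ?_⟩
  rw [abs_mul, abs_of_nonneg (mul_nonneg ht (Real.exp_nonneg _))]
  refine (mul_le_of_le_one_right (mul_nonneg ht (Real.exp_nonneg _)) (abs_sinc_le_one _)).trans ?_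
  have h1 : (a - c) * t ≤ Real.exp ((a - c) * t) := by
    linarith [Real.add_one_le_exp ((a - c) * t)]
  have h2 : Real.exp (-(c * t)) = Real.exp ((a - c) * t) * Real.exp (-(a * t)) := by
    rw [← Real.exp_add]
    ring_nf
  rw [h2, ← mul_assoc]
  refine mul_le_mul_of_nonneg_right ?_ (Real.exp_nonneg _)
  rw [one_div, le_inv_mul_iff₀ hδ]
  exact h1

lemma expDecay_exp_mul_cos (hca : c < a) :
    ExpDecay c (fun t => Real.exp (-(a * t)) * Real.cos (b * t)) := by
  refine ⟨1, fun t ht => ?_⟩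
  rw [abs_mul, Real.abs_exp, one_mul]
  refine (mul_le_of_le_one_right (Real.exp_nonneg _) (Real.abs_cos_le_one _)).trans ?_
  exact Real.exp_le_exp.2 (neg_le_neg (mul_le_mul_of_nonneg_right hca.le ht))

end Kernel

theorem stmt_2 {X : Type*} [NormedAddCommGroup X] [NormedSpace ℝ X] [CompleteSpace X]
    (T : ℝ → X →L[ℝ] X) (hT : IsSCSemigroup T) (A : X → X) (hA : IsGenerator T A)
    (ω M : ℝ) (hM : 0 ≤ M) (hbound : ∀ t : ℝ, 0 ≤ t → ‖T t‖ ≤ M * Real.exp (ω * t))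
    (a b : ℝ) (ha : ω < a) :
    Set.BijOn (fun x => A^[2] x - (2 * a) • A x + (a ^ 2 + b ^ 2) • x)
      (iterDomain T A 2) Set.univ ∧
    ∃ Q : X →L[ℝ] X,
      (∀ x ∈ iterDomain T A 2,
        Q (A^[2] x - (2 * a) • A x + (a ^ 2 + b ^ 2) • x) = x) ∧
      (∀ x : X, Q x ∈ iterDomain T A 2 ∧
        A^[2] (Q x) - (2 * a) • A (Q x) + (a ^ 2 + b ^ 2) • Q x = x) ∧
      ∀ x : X, Q x = ∫ t in Set.Ioi (0 : ℝ),
        (t * Real.exp (-(a * t)) * sinc (b * t)) • T t x := by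
  obtain ⟨c, hωc, hca⟩ := exists_between ha
  set f : ℝ → ℝ := fun t => t * Real.exp (-(a * t)) * sinc (b * t)
  set g : ℝ → ℝ := fun t => Real.exp (-(a * t)) * Real.cos (b * t)
  have hf := hasDerivAt_mul_exp_mul_sinc a b
  have hg := hasDerivAt_exp_mul_cos a b
  have hfd : ExpDecay c f := expDecay_mul_exp_mul_sinc b hca
  have hgd : ExpDecay c g := expDecay_exp_mul_cos b hca
  have hfc : Continuous f := continuous_iff_continuousAt.2 fun t => (hf t).continuousAt
  have hgc : Continuous g := by fun_prop
  have hintf := integrableOn_smul_orbit hT hbound hωc hfc hfd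
  have hintg := integrableOn_smul_orbit hT hbound hωc hgc hgd
  have hcomb (r s : ℝ) (u v : ℝ → ℝ) (x : X)
      (hu : IntegrableOn (fun t => u t • T t x) (Ioi 0))
      (hv : IntegrableOn (fun t => v t • T t x) (Ioi 0)) :
      ∫ t in Ioi (0 : ℝ), (-(r * u t + s * v t)) • T t x =
        -(r • (∫ t in Ioi (0 : ℝ), u t • T t x) + s • ∫ t in Ioi (0 : ℝ), v t • T t x) := by
    rw [← integral_smul, ← integral_smul, ← integral_add (hu.fun_smul r) (hv.fun_smul s),
      ← integral_neg]
    refine integral_congr_ae (Eventually.of_forall fun t => ?_)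
    module
  obtain ⟨Q, hQ⟩ := exists_clm_eq_integral_smul_orbit hT hbound hωc hfc hfd
  obtain ⟨R, hR⟩ := exists_clm_eq_integral_smul_orbit hT hbound hωc hgc hgd
  have hgenQ (x : X) : HasGen T (Q x) (a • Q x - R x) := by
    have h := hasGen_integral_smul_orbit hT hM hbound hωc hf hfd
      ((hfd.const_mul (-a)).add (hgd.const_mul 1)) x
    rw [hcomb _ _ f g x (hintf x) (hintg x), ← hQ, ← hR] at h
    convert h using 1
    simp
    abel
  have hgenR (x : X) : HasGen T (R x) (a • R x + b ^ 2 • Q x - x) := by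
    have h := hasGen_integral_smul_orbit hT hM hbound hωc hg hgd
      ((hgd.const_mul (-a)).add (hfd.const_mul (-b ^ 2))) x
    rw [hcomb _ _ g f x (hintg x) (hintf x), ← hQ, ← hR] at h
    convert h using 1
    simp [add_comm]
  have hAQ (x : X) : A (Q x) = a • Q x - R x := hA.eq_of_hasGen (hgenQ x)
  have hgenAQ (x : X) := (hgenQ x).const_smul_sub (hgenR x) a
  have hright (x : X) : Q x ∈ iterDomain T A 2 ∧
      A^[2] (Q x) - (2 * a) • A (Q x) + (a ^ 2 + b ^ 2) • Q x = x := by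
    refine ⟨⟨⟨trivial, (hgenQ x).mem_genDomain⟩, ?_⟩, ?_⟩
    · simpa [hAQ] using (hgenAQ x).mem_genDomain
    · simp only [Function.iterate_succ, Function.iterate_zero, Function.comp_apply, id, hAQ,
        hA.eq_of_hasGen (hgenAQ x)]
      module
  have hcomm (s : ℝ) (hs : 0 ≤ s) (z : X) : T s (Q z) = Q (T s z) := by
    rw [hQ, hQ, apply_integral_smul_orbit hT hbound hωc hfc hfd hs,
      integral_smul_orbit_apply hT hs]
  have hQA (x : X) (hx : x ∈ genDomain T) : Q (A x) = A (Q x) :=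
    (hA.eq_of_hasGen (HasGen.map (hA x hx) Q hcomm)).symm
  have hleft (x : X) (hx : x ∈ iterDomain T A 2) :
      Q (A^[2] x - (2 * a) • A x + (a ^ 2 + b ^ 2) • x) = x := by
    obtain ⟨⟨-, hx1⟩, hx2⟩ := hx
    have h := (hright x).2
    simp only [Function.iterate_succ, Function.iterate_zero, Function.comp_apply, id]
      at hx1 hx2 h ⊢
    rw [map_add, map_sub, map_smul, map_smul, hQA _ hx2, hQA _ hx1]
    exact h
  refine ⟨⟨fun _ _ => mem_univ _, fun x hx y hy hxy => ?_, fun x _ => ⟨Q x, hright x⟩⟩,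
    Q, hleft, hright, hQ⟩
  rw [← hleft x hx, ← hleft y hy]
  exact congrArg Q hxy
end
end

section
/- Let X be a real Banach space, let T : [0,∞) → B(X) be a strongly continuous semigroup with generator A, and let ω ∈ ℝ, M ≥ 0 satisfy ‖T(t)‖ ≤ M e^{ωt} for all t ≥ 0. Let a, b ∈ ℝ with a > ω, and let Q be the (bounded, everywhere defined) inverse of the bijective operator Δ := A² − 2a A + (a² + b²)·Id : D(A²) → X. Then ‖Q‖ ≤ M / (a − ω)². -/
open MeasureTheory Filter Set Quaternion

noncomputable section

/-- The fundamental solutions `S` and `C` of the oscillator equation with frequency `b`, with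
bounds uniform in `b`. -/
theorem exists_sine_cosine_pair (b : ℝ) : ∃ S C : ℝ → ℝ, S 0 = 0 ∧ C 0 = 1 ∧
    (∀ t, HasDerivAt S (C t) t) ∧ (∀ t, HasDerivAt C (-(b ^ 2 * S t)) t) ∧
    (∀ t, 0 ≤ t → |S t| ≤ t) ∧ ∀ t, |C t| ≤ 1 := by
  by_cases hb : b = 0
  · subst hb
    refine ⟨fun t => t, fun _ => 1, rfl, rfl, fun t => hasDerivAt_id' t, fun t => ?_,
      fun t ht => (abs_of_nonneg ht).le, fun t => by simp⟩
    simpa using hasDerivAt_const t (1 : ℝ)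
  · refine ⟨fun t => Real.sin (b * t) / b, fun t => Real.cos (b * t), by simp, by simp,
      fun t => ?_, fun t => ?_, fun t ht => ?_, fun t => Real.abs_cos_le_one _⟩
    · refine (((hasDerivAt_id' t).const_mul b).sin.div_const b).congr_deriv ?_
      field_simp
    · refine ((hasDerivAt_id' t).const_mul b).cos.congr_deriv ?_
      field_simp
    · rw [abs_div, div_le_iff₀ (abs_pos.mpr hb)]
      calc |Real.sin (b * t)| ≤ |b * t| := Real.abs_sin_le_abs
        _ = t * |b| := by rw [abs_mul, abs_of_nonneg ht, mul_comm]

section Semigroup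

variable {X : Type*} [NormedAddCommGroup X] [NormedSpace ℝ X] {T : ℝ → X →L[ℝ] X}

/-- Orbits of points in the domain of the generator are differentiable from the right. -/
theorem IsSCSemigroup.hasDerivWithinAt_orbit (hT : IsSCSemigroup T) {x y : X}
    (hx : Tendsto (fun h : ℝ => (1 / h) • (T h x - x)) (nhdsWithin 0 (Ioi 0)) (nhds y))
    {t : ℝ} (ht : 0 ≤ t) : HasDerivWithinAt (fun s => T s x) (T t y) (Ici t) t := by
  rw [← hasDerivWithinAt_Ioi_iff_Ici, hasDerivWithinAt_iff_tendsto_slope' self_notMem_Ioi]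
  have hshift : Tendsto (fun s : ℝ => s - t) (nhdsWithin t (Ioi t)) (nhdsWithin 0 (Ioi 0)) := by
    refine tendsto_nhdsWithin_iff.mpr ⟨?_, ?_⟩
    · have h : Tendsto (fun s : ℝ => s - t) (nhds t) (nhds (t - t)) :=
        (continuous_id.sub continuous_const).tendsto t
      rw [sub_self] at h
      exact h.mono_left nhdsWithin_le_nhds
    · filter_upwards [self_mem_nhdsWithin] with s hs
      exact sub_pos.mpr (mem_Ioi.mp hs)
  refine (((T t).continuous.tendsto y).comp (hx.comp hshift)).congr' ?_
  filter_upwards [self_mem_nhdsWithin] with s hs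
  have hsg := hT.2.1 (s - t) t (sub_pos.mpr (mem_Ioi.mp hs)).le ht
  rw [add_sub_cancel] at hsg
  simp [slope_def_module, hsg, one_div]

/-- Right derivative of the orbit of the rescaled semigroup `e^{-at} T(t)`. -/
theorem IsSCSemigroup.hasDerivWithinAt_rescaled_orbit (hT : IsSCSemigroup T) (a : ℝ) {x y : X}
    (hx : Tendsto (fun h : ℝ => (1 / h) • (T h x - x)) (nhdsWithin 0 (Ioi 0)) (nhds y))
    {t : ℝ} (ht : 0 ≤ t) :
    HasDerivWithinAt (fun s => Real.exp (-a * s) • T s x)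
      (Real.exp (-a * t) • T t (y - a • x)) (Ici t) t := by
  have he := (((hasDerivAt_id' t).const_mul (-a)).exp).hasDerivWithinAt (s := Ici t)
  refine (he.smul (hT.hasDerivWithinAt_orbit hx ht)).congr_deriv ?_
  simp only [map_sub, map_smul]
  module

theorem norm_rescaled_orbit_le {ω M : ℝ}
    (hbound : ∀ t : ℝ, 0 ≤ t → ‖T t‖ ≤ M * Real.exp (ω * t)) (a : ℝ) (x : X)
    {t : ℝ} (ht : 0 ≤ t) :
    ‖Real.exp (-a * t) • T t x‖ ≤ M * Real.exp (-((a - ω) * t)) * ‖x‖ := by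
  rw [norm_smul, Real.norm_of_nonneg (Real.exp_pos _).le]
  calc Real.exp (-a * t) * ‖T t x‖
      ≤ Real.exp (-a * t) * (M * Real.exp (ω * t) * ‖x‖) := by
        gcongr
        exact (T t).le_of_opNorm_le (hbound t ht) x
    _ = M * (Real.exp (-a * t) * Real.exp (ω * t)) * ‖x‖ := by ring
    _ = M * Real.exp (-((a - ω) * t)) * ‖x‖ := by rw [← Real.exp_add]; ring_nf

/-- A priori estimate for `((A - a)² + b²) x = w`, where `y = (A - a) x`
and `w - b² x = (A - a) y`. -/
theorem IsSCSemigroup.norm_le_of_quadratic (hT : IsSCSemigroup T) {ω M : ℝ} (hM : 0 ≤ M)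
    (hbound : ∀ t : ℝ, 0 ≤ t → ‖T t‖ ≤ M * Real.exp (ω * t)) {a : ℝ} (b : ℝ) (ha : ω < a)
    {x y w : X}
    (hx : Tendsto (fun h : ℝ => (1 / h) • (T h x - x)) (nhdsWithin 0 (Ioi 0)) (nhds (y + a • x)))
    (hy : Tendsto (fun h : ℝ => (1 / h) • (T h y - y)) (nhdsWithin 0 (Ioi 0))
      (nhds (w - b ^ 2 • x + a • y))) :
    ‖x‖ ≤ M / (a - ω) ^ 2 * ‖w‖ := by
  obtain ⟨S, C, hS0, hC0, hS, hC, hSle, hCle⟩ := exists_sine_cosine_pair b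
  set c := a - ω
  have hc : 0 < c := sub_pos.mpr ha
  let u : X → ℝ → X := fun z t => Real.exp (-a * t) • T t z
  have hu : ∀ z, ContinuousOn (u z) (Ici 0) := fun z =>
    (by fun_prop : Continuous fun t : ℝ => Real.exp (-a * t)).continuousOn.smul (hT.2.2 z)
  have hScont : Continuous S := continuous_iff_continuousAt.mpr fun t => (hS t).continuousAt
  have hCcont : Continuous C := continuous_iff_continuousAt.mpr fun t => (hC t).continuousAt
  let G : ℝ → X := fun t => S t • u y t - C t • u x t
  have hGcont : ContinuousOn G (Ici 0) :=
    (hScont.continuousOn.smul (hu y)).sub (hCcont.continuousOn.smul (hu x))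
  have hG0 : G 0 = -x := by simp [G, u, hS0, hC0, hT.1]
  have hGderiv : ∀ t, 0 ≤ t → HasDerivWithinAt G (S t • u w t) (Ici t) t := fun t ht => by
    have hux := hT.hasDerivWithinAt_rescaled_orbit a hx ht
    have huy := hT.hasDerivWithinAt_rescaled_orbit a hy ht
    rw [add_sub_cancel_right] at hux huy
    refine (((hS t).hasDerivWithinAt.smul huy).sub
      ((hC t).hasDerivWithinAt.smul hux)).congr_deriv ?_
    simp only [u, map_sub, map_smul]
    module
  let B : ℝ → ℝ := fun t =>
    M * ‖w‖ * (1 / c ^ 2 - Real.exp (-(c * t)) * (t / c + 1 / c ^ 2))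
  have hB : ∀ t, HasDerivAt B (M * ‖w‖ * (t * Real.exp (-(c * t)))) t := fun t => by
    have he := ((hasDerivAt_id' t).const_mul c).fun_neg.exp
    have hl := ((hasDerivAt_id' t).div_const c).add_const (1 / c ^ 2)
    refine (((he.mul hl).const_sub (1 / c ^ 2)).const_mul (M * ‖w‖)).congr_deriv ?_
    field_simp
    ring
  have hGle : ∀ t, 0 ≤ t → ‖G t + x‖ ≤ B t := fun t ht => by
    refine image_norm_le_of_norm_deriv_right_le_deriv_boundary (f := fun s => G s + x)
      (f' := fun s => S s • u w s) (a := 0) (b := t)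
      ((hGcont.mono Icc_subset_Ici_self).add continuousOn_const)
      (fun s hs => (hGderiv s hs.1).add_const x) ?_ hB (fun s hs => ?_) ⟨ht, le_rfl⟩
    · simp [hG0, B]
    · rw [norm_smul, Real.norm_eq_abs]
      calc |S s| * ‖u w s‖ ≤ s * (M * Real.exp (-(c * s)) * ‖w‖) :=
            mul_le_mul (hSle s hs.1) (norm_rescaled_orbit_le hbound a w hs.1)
              (norm_nonneg _) hs.1
        _ = M * ‖w‖ * (s * Real.exp (-(c * s))) := by ring
  have hxle : ∀ t, 0 ≤ t → ‖x‖ ≤ M / c ^ 2 * ‖w‖ +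
      (M * ‖y‖ * (t * Real.exp (-(c * t))) + M * ‖x‖ * Real.exp (-(c * t))) := fun t ht => by
    have hBle : B t ≤ M / c ^ 2 * ‖w‖ := by
      have h : 0 ≤ M * ‖w‖ * (Real.exp (-(c * t)) * (t / c + 1 / c ^ 2)) := by positivity
      calc B t = M / c ^ 2 * ‖w‖ -
            M * ‖w‖ * (Real.exp (-(c * t)) * (t / c + 1 / c ^ 2)) := by simp only [B]; ring
        _ ≤ M / c ^ 2 * ‖w‖ := sub_le_self _ h
    have hGt : ‖G t‖ ≤ M * ‖y‖ * (t * Real.exp (-(c * t))) + M * ‖x‖ * Real.exp (-(c * t)) := by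
      calc ‖G t‖ ≤ |S t| * ‖u y t‖ + |C t| * ‖u x t‖ := by
            simpa only [norm_smul, Real.norm_eq_abs] using norm_sub_le (S t • u y t) (C t • u x t)
        _ ≤ t * (M * Real.exp (-(c * t)) * ‖y‖) + 1 * (M * Real.exp (-(c * t)) * ‖x‖) :=
            add_le_add
              (mul_le_mul (hSle t ht) (norm_rescaled_orbit_le hbound a y ht) (norm_nonneg _) ht)
              (mul_le_mul (hCle t) (norm_rescaled_orbit_le hbound a x ht) (norm_nonneg _)
                zero_le_one)
        _ = _ := by ring
    calc ‖x‖ = ‖(G t + x) - G t‖ := by rw [add_sub_cancel_left]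
      _ ≤ ‖G t + x‖ + ‖G t‖ := norm_sub_le _ _
      _ ≤ _ := add_le_add ((hGle t ht).trans hBle) hGt
  have hct : Tendsto (fun t : ℝ => c * t) atTop atTop := tendsto_id.const_mul_atTop hc
  have hexp : Tendsto (fun t : ℝ => Real.exp (-(c * t))) atTop (nhds 0) :=
    Real.tendsto_exp_neg_atTop_nhds_zero.comp hct
  have htexp : Tendsto (fun t : ℝ => t * Real.exp (-(c * t))) atTop (nhds 0) := by
    have h := ((Real.tendsto_pow_mul_exp_neg_atTop_nhds_zero 1).comp hct).const_mul c⁻¹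
    rw [mul_zero] at h
    refine h.congr fun t => ?_
    simp only [Function.comp, pow_one]
    field_simp
  have hlim := ((htexp.const_mul (M * ‖y‖)).add (hexp.const_mul (M * ‖x‖))).const_add
    (M / c ^ 2 * ‖w‖)
  simp only [mul_zero, add_zero] at hlim
  exact ge_of_tendsto hlim (eventually_atTop.mpr ⟨0, hxle⟩)

end Semigroup

theorem stmt_5 {X : Type*} [NormedAddCommGroup X] [NormedSpace ℝ X] [CompleteSpace X]
    (T : ℝ → X →L[ℝ] X) (hT : IsSCSemigroup T) (A : X → X) (hA : IsGenerator T A)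
    (ω M : ℝ) (hM : 0 ≤ M) (hbound : ∀ t : ℝ, 0 ≤ t → ‖T t‖ ≤ M * Real.exp (ω * t))
    (a b : ℝ) (ha : ω < a) (Q : X →L[ℝ] X)
    (hQleft : ∀ x ∈ iterDomain T A 2,
      Q (A^[2] x - (2 * a) • A x + (a ^ 2 + b ^ 2) • x) = x)
    (hQright : ∀ x : X, Q x ∈ iterDomain T A 2 ∧
      A^[2] (Q x) - (2 * a) • A (Q x) + (a ^ 2 + b ^ 2) • Q x = x) :
    ‖Q‖ ≤ M / (a - ω) ^ 2 := by
  refine Q.opNorm_le_bound (by positivity) fun w => ?_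
  obtain ⟨⟨⟨-, hx⟩, hAx⟩, hw⟩ := hQright w
  simp only [Function.iterate_succ, Function.iterate_zero, Function.comp, id] at hx hAx hw
  set x := Q w
  refine hT.norm_le_of_quadratic hM hbound b ha (y := A x - a • x) ?_ ?_
  · simpa using hA x hx
  · have h := (hA (A x) hAx).sub ((hA x hx).const_smul a)
    convert h using 1
    · funext s
      simp only [map_sub, map_smul]
      module
    · congr 1
      rw [← hw]
      module
end
end

section
/- Let X be a Banach two-sided ℍ-module and let T : [0,∞) → B(X) be a strongly continuous right linear semigroup with generator A, and let ω ∈ ℝ, M ≥ 0 satisfy ‖T(t)‖ ≤ M e^{ωt} for all t ≥ 0. Let q ∈ ℍ with Re(q) > ω, let Q_q(A) be the bounded inverse of the bijective operator Δ_q(A) := A² − 2 Re(q) A + |q|²·Id : D(A²) → X, and let C_q(A) be the spherical resolvent operator defined by C_q(A)x := Q_q(A)(q̄ x) − A(Q_q(A)x). Then ‖C_q(A)‖ ≤ M / (Re(q) − ω). -/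
open MeasureTheory Filter Set Quaternion

noncomputable section

section Quaternion

/-- Polar form of the imaginary part of a quaternion, with `u = 0` allowed when `q` is real. -/
lemma exists_eq_re_add_smul (q : ℍ[ℝ]) : ∃ (b : ℝ) (u : ℍ[ℝ]),
    q = (q.re : ℍ[ℝ]) + b • u ∧ u.re = 0 ∧ normSq u ≤ 1 ∧ b • (u * u) = ((-b : ℝ) : ℍ[ℝ]) := by
  rcases eq_or_ne q.im 0 with h | h
  · refine ⟨0, 0, ?_, by simp, by simp, by simp⟩
    simpa [h] using (q.re_add_im).symm
  · have hb : ‖q.im‖ ≠ 0 := norm_ne_zero_iff.mpr h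
    refine ⟨‖q.im‖, ‖q.im‖⁻¹ • q.im, ?_, by simp, ?_, ?_⟩
    · rw [smul_smul, mul_inv_cancel₀ hb, one_smul, q.re_add_im]
    · rw [Quaternion.normSq_smul, normSq_eq_norm_mul_self]
      apply le_of_eq
      field_simp
    · rw [smul_mul_smul_comm, ← pow_two q.im, im_sq, normSq_eq_norm_mul_self, smul_smul,
        ← coe_neg, ← coe_smul]
      congr 1
      rw [smul_eq_mul]
      field_simp

lemma norm_cos_sub_sin_smul_le_one {u : ℍ[ℝ]} (hre : u.re = 0) (hu : normSq u ≤ 1) (θ : ℝ) :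
    ‖((Real.cos θ : ℝ) : ℍ[ℝ]) - Real.sin θ • u‖ ≤ 1 := by
  have h : normSq (((Real.cos θ : ℝ) : ℍ[ℝ]) - Real.sin θ • u)
      = Real.cos θ ^ 2 + Real.sin θ ^ 2 * normSq u := by
    simp only [normSq_def', re_sub, imI_sub, imJ_sub, imK_sub, re_coe, imI_coe, imJ_coe, imK_coe,
      re_smul, imI_smul, imJ_smul, imK_smul, hre, smul_eq_mul]
    ring
  rw [normSq_eq_norm_mul_self] at h
  nlinarith [Real.sin_sq_add_cos_sq θ, sq_nonneg (Real.sin θ),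
    norm_nonneg (((Real.cos θ : ℝ) : ℍ[ℝ]) - Real.sin θ • u)]

end Quaternion

section Generator

variable {X : Type*} [NormedAddCommGroup X] [NormedSpace ℝ X] {T : ℝ → X →L[ℝ] X} {A : X → X}

lemma IsGenerator.mem_and_eq (hA : IsGenerator T A) {x y : X}
    (h : Tendsto (fun h : ℝ => (1 / h) • (T h x - x)) (nhdsWithin 0 (Set.Ioi 0)) (nhds y)) :
    x ∈ genDomain T ∧ A x = y :=
  ⟨⟨y, h⟩, tendsto_nhds_unique (hA x ⟨y, h⟩) h⟩

lemma IsGenerator.map_add (hA : IsGenerator T A) {x y : X} (hx : x ∈ genDomain T)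
    (hy : y ∈ genDomain T) : x + y ∈ genDomain T ∧ A (x + y) = A x + A y := by
  refine hA.mem_and_eq (((hA x hx).add (hA y hy)).congr fun h => ?_)
  rw [_root_.map_add, ← smul_add]
  congr 1
  abel

lemma IsGenerator.map_smul (hA : IsGenerator T A) {x : X} (r : ℝ) (hx : x ∈ genDomain T) :
    r • x ∈ genDomain T ∧ A (r • x) = r • A x := by
  refine hA.mem_and_eq (((hA x hx).const_smul r).congr fun h => ?_)
  rw [_root_.map_smul, ← smul_sub, smul_comm]

lemma IsGenerator.map_sub (hA : IsGenerator T A) {x y : X} (hx : x ∈ genDomain T)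
    (hy : y ∈ genDomain T) : x - y ∈ genDomain T ∧ A (x - y) = A x - A y := by
  have hy' := hA.map_smul (-1) hy
  have h := hA.map_add hx hy'.1
  rw [hy'.2] at h
  simpa [sub_eq_add_neg] using h

/-- Orbits starting in the domain of the generator are differentiable from the right. -/
lemma IsSCSemigroup.hasDerivWithinAt (hT : IsSCSemigroup T) (hA : IsGenerator T A) {x : X}
    (hx : x ∈ genDomain T) {t : ℝ} (ht : 0 ≤ t) :
    HasDerivWithinAt (fun s => T s x) (T t (A x)) (Set.Ici t) t := by
  rw [← hasDerivWithinAt_Ioi_iff_Ici, hasDerivWithinAt_iff_tendsto_slope' self_notMem_Ioi]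
  have hshift : Tendsto (fun s : ℝ => s - t) (nhdsWithin t (Set.Ioi t))
      (nhdsWithin 0 (Set.Ioi 0)) := by
    refine tendsto_nhdsWithin_iff.mpr ⟨?_, ?_⟩
    · have : Tendsto (fun s : ℝ => s - t) (nhds t) (nhds (t - t)) :=
        (continuous_id.sub continuous_const).tendsto t
      rw [sub_self] at this
      exact this.mono_left nhdsWithin_le_nhds
    · filter_upwards [self_mem_nhdsWithin] with s hs using sub_pos.mpr (mem_Ioi.mp hs)
  refine (((T t).continuous.tendsto _).comp ((hA x hx).comp hshift)).congr' ?_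
  filter_upwards [self_mem_nhdsWithin] with s hs
  have h := hT.2.1 (s - t) t (sub_pos.mpr (mem_Ioi.mp hs)).le ht
  rw [add_sub_cancel] at h
  simp [slope_def_module, h]

end Generator

theorem stmt_6 {X : Type*} [NormedAddCommGroup X] [NormedSpace ℝ X] [CompleteSpace X]
    [Module ℍ[ℝ] X] [Module ℍ[ℝ]ᵐᵒᵖ X] [SMulCommClass ℍ[ℝ] ℍ[ℝ]ᵐᵒᵖ X]
    [IsScalarTower ℝ ℍ[ℝ] X]
    (hL : ∀ (p : ℍ[ℝ]) (x : X), ‖p • x‖ ≤ ‖p‖ * ‖x‖)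
    (hR : ∀ (p : ℍ[ℝ]) (x : X), ‖(MulOpposite.op p) • x‖ ≤ ‖p‖ * ‖x‖)
    (hreal : ∀ (r : ℝ) (x : X), (MulOpposite.op (r : ℍ[ℝ])) • x = r • x)
    (T : ℝ → X →L[ℝ] X) (hT : IsSCSemigroup T)
    (hTright : ∀ t ∈ Set.Ici (0 : ℝ), ∀ (p : ℍ[ℝ]) (x : X),
      T t ((MulOpposite.op p) • x) = (MulOpposite.op p) • T t x)
    (A : X → X) (hA : IsGenerator T A)
    (ω M : ℝ) (hM : 0 ≤ M) (hbound : ∀ t : ℝ, 0 ≤ t → ‖T t‖ ≤ M * Real.exp (ω * t))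
    (q : ℍ[ℝ]) (hq : ω < q.re) (Q : X →L[ℝ] X)
    (hQleft : ∀ x ∈ iterDomain T A 2,
      Q (A^[2] x - (2 * q.re) • A x + ‖q‖ ^ 2 • x) = x)
    (hQright : ∀ x : X, Q x ∈ iterDomain T A 2 ∧
      A^[2] (Q x) - (2 * q.re) • A (Q x) + ‖q‖ ^ 2 • Q x = x) :
    ∀ x : X, ‖Q ((star q) • x) - A (Q x)‖ ≤ (M / (q.re - ω)) * ‖x‖ := by
  intro x
  obtain ⟨b, u, hqu, hure, hun, hbu⟩ := exists_eq_re_add_smul q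
  set a := q.re with ha
  have coe_smul_X : ∀ (r : ℝ) (y : X), (r : ℍ[ℝ]) • y = r • y := fun r y => by
    rw [← mul_one (r : ℍ[ℝ]), coe_mul_eq_smul, smul_assoc, one_smul]
  have q_smul : ∀ y : X, q • y = a • y + b • u • y := fun y => by
    conv_lhs => rw [hqu]
    rw [add_smul, coe_smul_X, smul_assoc]
  have star_q_smul : ∀ y : X, star q • y = a • y - b • u • y := fun y => by
    have : star q = ((2 * a : ℝ) : ℍ[ℝ]) - q := by
      rw [star_eq_two_re_sub]
    rw [this, sub_smul, coe_smul_X, q_smul, two_mul, add_smul]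
    abel
  have uu_smul : ∀ y : X, b • u • u • y = -(b • y) := fun y => by
    rw [smul_smul u, ← smul_assoc, hbu, coe_smul_X, neg_smul]
  have dQ : ∀ y, Q y ∈ genDomain T := fun y => (hQright y).1.1.2
  have dAQ : ∀ y, A (Q y) ∈ genDomain T := fun y => (hQright y).1.2
  have AQ_sub : ∀ y z, A (Q (y - z)) = A (Q y) - A (Q z) := fun y z => by
    rw [_root_.map_sub, (hA.map_sub (dQ y) (dQ z)).2]
  have AQ_smul : ∀ (r : ℝ) y, A (Q (r • y)) = r • A (Q y) := fun r y => by
    rw [_root_.map_smul, (hA.map_smul r (dQ y)).2]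
  set C : X → X := fun y => Q (star q • y) - A (Q y) with hC
  have dC : ∀ y, C y ∈ genDomain T := fun y => (hA.map_sub (dQ _) (dAQ _)).1
  have C_smul : ∀ (r : ℝ) y, C (r • y) = r • C y := fun r y => by
    simp only [hC, AQ_smul]
    simp only [smul_comm (star q) r y, _root_.map_smul, smul_sub]
  have norm_q_smul : ∀ y : X, ‖q‖ ^ 2 • y = a • (a • y) + b • (b • y) := fun y => by
    have h : star q • q • y = ‖q‖ ^ 2 • y := by
      rw [smul_smul, star_mul_self, coe_smul_X, normSq_eq_norm_mul_self, sq]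
    rw [← h, star_q_smul, q_smul, smul_add u, smul_comm u a, smul_add, smul_comm u b,
      uu_smul, smul_add, smul_neg, smul_comm b a]
    abel
  have AC : ∀ y, A (C y) = -y + (a • C y + b • C (u • y)) := fun y => by
    have h1 : A (C y) = A (Q (star q • y)) - A (A (Q y)) := (hA.map_sub (dQ _) (dAQ _)).2
    have h2 : A (A (Q y)) - (2 * a) • A (Q y) + ‖q‖ ^ 2 • Q y = y := (hQright y).2
    have h3 : A (A (Q y)) = y + (2 * a) • A (Q y) - ‖q‖ ^ 2 • Q y := by
      conv_rhs => lhs; lhs; rw [← h2]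
      abel
    have h4 : b • Q (b • u • u • y) = -(b • b • Q y) := by
      rw [uu_smul, _root_.map_neg, _root_.map_smul, smul_neg]
    rw [_root_.map_smul] at h4
    rw [h1, h3, norm_q_smul]
    simp only [hC, star_q_smul, AQ_sub, AQ_smul]
    simp only [_root_.map_sub, _root_.map_smul, smul_sub, h4]
    module
  set F : ℝ → X := fun t =>
    Real.exp (-(a * t)) • (Real.cos (b * t) • T t (C x) - Real.sin (b * t) • T t (C (u • x)))
    with hF
  set F' : ℝ → X := fun t =>
    -(Real.exp (-(a * t)) • T t (((Real.cos (b * t) : ℍ[ℝ]) - Real.sin (b * t) • u) • x)) with hF'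
  have hderiv : ∀ t, 0 ≤ t → HasDerivWithinAt F (F' t) (Set.Ici t) t := by
    intro t ht
    have h1 := hT.hasDerivWithinAt hA (dC x) ht
    have h2 := hT.hasDerivWithinAt hA (dC (u • x)) ht
    have hlin : ∀ r : ℝ, HasDerivAt (fun s => r * s) r t := fun r => by
      simpa using (hasDerivAt_id t).const_mul r
    have he := ((hlin a).fun_neg.exp).hasDerivWithinAt (s := Set.Ici t)
    have hc := ((hlin b).cos).hasDerivWithinAt (s := Set.Ici t)
    have hs := ((hlin b).sin).hasDerivWithinAt (s := Set.Ici t)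
    refine (he.fun_smul ((hc.fun_smul h1).fun_sub (hs.fun_smul h2))).congr_deriv ?_
    have h5 : b • C (u • u • x) = -(b • C x) := by
      rw [← C_smul, uu_smul, ← neg_smul, C_smul, neg_smul]
    rw [AC, AC, h5]
    simp only [hF', sub_smul, coe_smul_X, smul_assoc, _root_.map_sub, _root_.map_add,
      _root_.map_smul, _root_.map_neg]
    module
  have hcont : ContinuousOn F (Set.Ici 0) := by
    have h1 := hT.2.2 (C x)
    have h2 := hT.2.2 (C (u • x))
    have he : Continuous fun t : ℝ => Real.exp (-(a * t)) := by fun_prop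
    have hc : Continuous fun t : ℝ => Real.cos (b * t) := by fun_prop
    have hs : Continuous fun t : ℝ => Real.sin (b * t) := by fun_prop
    exact he.continuousOn.smul ((hc.continuousOn.smul h1).sub (hs.continuousOn.smul h2))
  have hexp : ∀ t, Real.exp (-(a * t)) * Real.exp (ω * t) = Real.exp (-((a - ω) * t)) := fun t => by
    rw [← Real.exp_add]
    congr 1
    ring
  have hTle : ∀ t, 0 ≤ t → ∀ y, Real.exp (-(a * t)) * ‖T t y‖
      ≤ M * Real.exp (-((a - ω) * t)) * ‖y‖ := fun t ht y => by
    calc Real.exp (-(a * t)) * ‖T t y‖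
        ≤ Real.exp (-(a * t)) * (M * Real.exp (ω * t) * ‖y‖) := by
          gcongr
          exact (T t).le_of_opNorm_le (hbound t ht) y
      _ = M * Real.exp (-((a - ω) * t)) * ‖y‖ := by
          rw [← hexp]
          ring
  have hF'le : ∀ t, 0 ≤ t → ‖F' t‖ ≤ M * Real.exp (-((a - ω) * t)) * ‖x‖ := by
    intro t ht
    rw [hF', norm_neg, norm_smul, Real.norm_of_nonneg (Real.exp_pos _).le]
    refine (hTle t ht _).trans ?_
    gcongr
    refine (hL _ x).trans ?_
    exact mul_le_of_le_one_left (norm_nonneg x) (norm_cos_sub_sin_smul_le_one hure hun _)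
  have haω : 0 < a - ω := sub_pos.mpr hq
  have hdiff : ∀ t, 0 ≤ t → ‖F t - F 0‖
      ≤ M / (a - ω) * ‖x‖ * (1 - Real.exp (-((a - ω) * t))) := by
    intro t ht
    refine image_norm_le_of_norm_deriv_right_le_deriv_boundary (a := 0) (b := t)
      (f := fun s => F s - F 0) (f' := F')
      (B := fun s => M / (a - ω) * ‖x‖ * (1 - Real.exp (-((a - ω) * s))))
      (B' := fun s => M * Real.exp (-((a - ω) * s)) * ‖x‖) ?_ ?_ ?_ ?_ ?_ ⟨ht, le_rfl⟩
    · exact (hcont.mono Icc_subset_Ici_self).sub continuousOn_const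
    · exact fun s hs => (hderiv s hs.1).sub_const _
    · simp
    · intro s
      have hlin : HasDerivAt (fun s => (a - ω) * s) (a - ω) s := by
        simpa using (hasDerivAt_id s).const_mul (a - ω)
      refine ((hlin.fun_neg.exp.const_sub 1).const_mul _).congr_deriv ?_
      field_simp
    · exact fun s hs => hF'le s hs.1
  have hFle : ∀ t, 0 ≤ t → ‖F t‖
      ≤ M * Real.exp (-((a - ω) * t)) * (‖C x‖ + ‖C (u • x)‖) := by
    intro t ht
    have h1 : ‖Real.cos (b * t) • T t (C x)‖ ≤ ‖T t (C x)‖ := by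
      rw [norm_smul]
      exact mul_le_of_le_one_left (norm_nonneg _) (Real.abs_cos_le_one _)
    have h2 : ‖Real.sin (b * t) • T t (C (u • x))‖ ≤ ‖T t (C (u • x))‖ := by
      rw [norm_smul]
      exact mul_le_of_le_one_left (norm_nonneg _) (Real.abs_sin_le_one _)
    rw [hF, norm_smul, Real.norm_of_nonneg (Real.exp_pos _).le, mul_add]
    refine le_trans ?_ (add_le_add (hTle t ht _) (hTle t ht _))
    rw [← mul_add]
    gcongr
    exact (norm_sub_le _ _).trans (add_le_add h1 h2)
  have hF0 : F 0 = C x := by simp [hF, hT.1]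
  have hle : ∀ t, 0 ≤ t → ‖C x‖ ≤ M * Real.exp (-((a - ω) * t)) * (‖C x‖ + ‖C (u • x)‖)
      + M / (a - ω) * ‖x‖ * (1 - Real.exp (-((a - ω) * t))) := by
    intro t ht
    calc ‖C x‖ = ‖F 0‖ := by rw [hF0]
      _ ≤ ‖F t‖ + ‖F t - F 0‖ := norm_le_norm_add_norm_sub _ _
      _ ≤ _ := add_le_add (hFle t ht) (hdiff t ht)
  have hlim : Tendsto (fun t => Real.exp (-((a - ω) * t))) atTop (nhds 0) :=
    Real.tendsto_exp_neg_atTop_nhds_zero.comp (tendsto_id.const_mul_atTop haω)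
  have hlim' : Tendsto (fun t => M * Real.exp (-((a - ω) * t)) * (‖C x‖ + ‖C (u • x)‖)
      + M / (a - ω) * ‖x‖ * (1 - Real.exp (-((a - ω) * t)))) atTop
      (nhds (M * 0 * (‖C x‖ + ‖C (u • x)‖) + M / (a - ω) * ‖x‖ * (1 - 0))) :=
    ((hlim.const_mul M).mul_const _).add ((hlim.const_sub 1).const_mul _)
  simp only [mul_zero, zero_mul, zero_add, sub_zero, mul_one] at hlim'
  exact ge_of_tendsto hlim' (eventually_atTop.mpr ⟨0, hle⟩)
end
end

section
/- Let X be a real Banach space, let T : [0,∞) → B(X) be a strongly continuous semigroup with generator A, and let ω ∈ ℝ, M ≥ 0 satisfy ‖T(t)‖ ≤ M e^{ωt} for all t ≥ 0. Let a, b ∈ ℝ with a > ω, and let Q be the (bounded, everywhere defined) inverse of the bijective operator Δ := A² − 2a A + (a² + b²)·Id : D(A²) → X. Then for every integer n ≥ 1 one has ‖Q^n‖ ≤ M / (a − ω)^{2n}. -/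
open MeasureTheory Filter Set Quaternion

noncomputable section

section

variable {X : Type*} [NormedAddCommGroup X] [NormedSpace ℝ X]

/-- Orbits starting in the domain of the generator are right differentiable. -/
lemma IsSCSemigroup.hasDerivWithinAt_orbit_s7 {T : ℝ → X →L[ℝ] X} (hT : IsSCSemigroup T) {A : X → X}
    (hA : IsGenerator T A) {y : X} (hy : y ∈ genDomain T) {r : ℝ} (hr : 0 ≤ r) :
    HasDerivWithinAt (fun s => T s y) (T r (A y)) (Ici r) r := by
  rw [hasDerivWithinAt_iff_tendsto_slope, Ici_sdiff_left]
  have hshift : Tendsto (fun s : ℝ => s - r) (nhdsWithin r (Ioi r)) (nhdsWithin 0 (Ioi 0)) := by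
    refine tendsto_nhdsWithin_iff.2 ⟨?_, ?_⟩
    · have : Tendsto (fun s : ℝ => s - r) (nhds r) (nhds (r - r)) :=
        (continuous_id.sub continuous_const).tendsto r
      rw [sub_self] at this
      exact this.mono_left nhdsWithin_le_nhds
    · filter_upwards [self_mem_nhdsWithin] with s hs
      exact sub_pos.2 (mem_Ioi.1 hs)
  have hlim := ((T r).continuous.tendsto _).comp ((hA y hy).comp hshift)
  refine hlim.congr' ?_
  filter_upwards [self_mem_nhdsWithin] with s hs
  have hsplit := hT.2.1 (s - r) r (sub_nonneg.2 (le_of_lt hs)) hr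
  rw [add_sub_cancel] at hsplit
  simp [slope_def_module, hsplit]

/-- The solution of `k'' = -b² k`, `k 0 = 0`, `k' 0 = 1`, with elementary bounds. -/
lemma exists_oscillation_kernel (b : ℝ) : ∃ k k' : ℝ → ℝ,
    (∀ r, HasDerivAt k (k' r) r) ∧ (∀ r, HasDerivAt k' (-(b ^ 2 * k r)) r) ∧
    k 0 = 0 ∧ k' 0 = 1 ∧ (∀ r, |k r| ≤ |r|) ∧ ∀ r, |k' r| ≤ 1 := by
  rcases eq_or_ne b 0 with rfl | hb
  · refine ⟨id, fun _ => 1, fun r => hasDerivAt_id r, fun r => ?_, rfl, rfl, fun r => le_rfl,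
      by simp⟩
    simpa using hasDerivAt_const r (1 : ℝ)
  · have hlin : ∀ r, HasDerivAt (fun r : ℝ => b * r) b r := fun r => by
      simpa using (hasDerivAt_id r).const_mul b
    refine ⟨fun r => Real.sin (b * r) / b, fun r => Real.cos (b * r), fun r => ?_, fun r => ?_,
      by simp, by simp, fun r => ?_, fun r => Real.abs_cos_le_one _⟩
    · exact ((hlin r).sin.div_const b).congr_deriv (mul_div_cancel_right₀ _ hb)
    · refine (hlin r).cos.congr_deriv ?_
      field_simp
    · rw [abs_div, div_le_iff₀ (abs_pos.2 hb), mul_comm |r|, ← abs_mul]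
      exact Real.abs_sin_le_abs

/-- If the orbit of `(A² - 2a A + (a² + b²)) y` is bounded by `C * exp (ω t)`, then the orbit of `y`
is bounded by `C / (a - ω)² * exp (ω t)`. -/
lemma IsSCSemigroup.norm_orbit_le_of_quadratic {T : ℝ → X →L[ℝ] X} (hT : IsSCSemigroup T)
    {A : X → X} (hA : IsGenerator T A) {ω M : ℝ}
    (hbound : ∀ t : ℝ, 0 ≤ t → ‖T t‖ ≤ M * Real.exp (ω * t)) {a b : ℝ} (ha : ω < a) {x y : X}
    (hy : y ∈ genDomain T) (hAy : A y ∈ genDomain T)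
    (hxy : A (A y) - (2 * a) • A y + (a ^ 2 + b ^ 2) • y = x) {C : ℝ}
    (hx : ∀ t : ℝ, 0 ≤ t → ‖T t x‖ ≤ C * Real.exp (ω * t)) {t : ℝ} (ht : 0 ≤ t) :
    ‖T t y‖ ≤ C / (a - ω) ^ 2 * Real.exp (ω * t) := by
  obtain ⟨k, k', hk, hk', hk0, hk'0, hkb, hk'b⟩ := exists_oscillation_kernel b
  have hc : 0 < a - ω := sub_pos.2 ha
  set c := a - ω with hcdef
  have hC : 0 ≤ C := by simpa using (norm_nonneg _).trans (hx 0 le_rfl)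
  set D := C * Real.exp (ω * t) with hD
  have hD0 : 0 ≤ D := by positivity
  set e : ℝ → ℝ := fun r => Real.exp (-(a * r)) with he
  have hed : ∀ r, HasDerivAt e (-a * e r) r := fun r => by
    have h1 : HasDerivAt (fun r : ℝ => -(a * r)) (-a) r := by
      simpa using ((hasDerivAt_id r).const_mul a).fun_neg
    convert h1.exp using 1
    simp only [he]; ring
  set G : ℝ → X := fun r => T t ((e r * k r) • T r (A y) - (e r * (a * k r + k' r)) • T r y) with hG
  have hGd : ∀ r, 0 ≤ r → HasDerivWithinAt G (T t ((e r * k r) • T r x)) (Ici r) r := by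
    intro r hr
    have h1 := ((hed r).mul (hk r)).hasDerivWithinAt (s := Ici r) |>.smul
      (hT.hasDerivWithinAt_orbit_s7 hA hAy hr)
    have h2 := ((hed r).mul (((hk r).const_mul a).add (hk' r))).hasDerivWithinAt (s := Ici r) |>.smul
      (hT.hasDerivWithinAt_orbit_s7 hA hy hr)
    have h3 := (T t).hasFDerivAt.comp_hasDerivWithinAt r (h1.sub h2)
    refine h3.congr_deriv (congrArg (T t) ?_)
    rw [← hxy]
    simp only [map_add, map_sub, map_smul, Pi.mul_apply, Pi.add_apply]
    module
  have hGc : ContinuousOn G (Ici 0) := by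
    have hec : Continuous e := continuous_iff_continuousAt.2 fun r => (hed r).continuousAt
    have hkc : Continuous k := continuous_iff_continuousAt.2 fun r => (hk r).continuousAt
    have hk'c : Continuous k' := continuous_iff_continuousAt.2 fun r => (hk' r).continuousAt
    exact (T t).continuous.comp_continuousOn
      (((hec.mul hkc).continuousOn.smul (hT.2.2 (A y))).sub
        ((hec.mul ((continuous_const.mul hkc).add hk'c)).continuousOn.smul (hT.2.2 y)))
  have hG0 : G 0 = -(T t y) := by simp [hG, he, hk0, hk'0, hT.1]
  have hee : ∀ r, e r * Real.exp (ω * r) = Real.exp (-(c * r)) := fun r => by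
    rw [← Real.exp_add]; congr 1; rw [hcdef]; ring
  set B : ℝ → ℝ := fun r => D * (1 / c ^ 2 - Real.exp (-(c * r)) * (r / c + 1 / c ^ 2)) with hB
  have hBd : ∀ r, HasDerivAt B (D * (r * Real.exp (-(c * r)))) r := by
    intro r
    have h1 : HasDerivAt (fun r : ℝ => -(c * r)) (-c) r := by
      simpa using ((hasDerivAt_id r).const_mul c).fun_neg
    have h2 : HasDerivAt (fun r : ℝ => r / c + 1 / c ^ 2) (1 / c) r :=
      ((hasDerivAt_id r).div_const c).add_const _
    refine (((h1.exp.mul h2).const_sub (1 / c ^ 2)).const_mul D).congr_deriv ?_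
    field_simp
    ring
  have hGle : ∀ r, 0 ≤ r → ‖T t y‖ ≤ D / c ^ 2 + ‖G r‖ := by
    intro r hr
    have hmvt := image_norm_le_of_norm_deriv_right_le_deriv_boundary
      (f := fun r => G r - G 0) (a := 0) (b := r) (B := B)
      ((hGc.mono Icc_subset_Ici_self).sub continuousOn_const)
      (fun s hs => (hGd s hs.1).sub_const _) (by simp [hB]) hBd
      (fun s hs => by
        have hs0 : 0 ≤ s := hs.1
        have hTs : T t (T s x) = T (t + s) x := by rw [hT.2.1 s t hs0 ht]; rfl
        have hks : |k s| ≤ s := (hkb s).trans_eq (abs_of_nonneg hs0)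
        have hes : |e s| = e s := abs_of_pos (Real.exp_pos _)
        rw [map_smul, norm_smul, hTs, Real.norm_eq_abs, abs_mul, hes]
        calc e s * |k s| * ‖T (t + s) x‖
            ≤ e s * s * (C * Real.exp (ω * (t + s))) := by
              have := hx (t + s) (by positivity)
              have : 0 ≤ e s := (Real.exp_pos _).le
              gcongr
          _ = D * (s * (e s * Real.exp (ω * s))) := by rw [mul_add, Real.exp_add, hD]; ring
          _ = D * (s * Real.exp (-(c * s))) := by rw [hee])
      (right_mem_Icc.2 hr)
    have hBle : B r ≤ D / c ^ 2 := by
      have : 0 ≤ D * (Real.exp (-(c * r)) * (r / c + 1 / c ^ 2)) := by positivity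
      simp only [hB, mul_sub, mul_one_div]
      simpa [mul_one_div] using this
    calc ‖T t y‖ = ‖(G r - G 0) - G r‖ := by rw [hG0]; congr 1; abel
      _ ≤ ‖G r - G 0‖ + ‖G r‖ := norm_sub_le _ _
      _ ≤ D / c ^ 2 + ‖G r‖ := by gcongr; exact hmvt.trans hBle
  have hGlim : Tendsto G atTop (nhds 0) := by
    have hdecay : Tendsto (fun r : ℝ => Real.exp (-(c * r))) atTop (nhds 0) :=
      Real.tendsto_exp_neg_atTop_nhds_zero.comp (tendsto_id.const_mul_atTop hc)
    have hdecay' : Tendsto (fun r : ℝ => r * Real.exp (-(c * r))) atTop (nhds 0) := by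
      have h1 := (Real.tendsto_pow_mul_exp_neg_atTop_nhds_zero 1).comp
        (tendsto_id.const_mul_atTop hc)
      have h2 := h1.const_mul c⁻¹
      rw [mul_zero] at h2
      refine h2.congr fun r => ?_
      simp only [Function.comp_apply, id, pow_one]
      field_simp
    have hmajor : Tendsto (fun r : ℝ => ‖T t‖ * (M * ‖A y‖ + |a| * M * ‖y‖) *
        (r * Real.exp (-(c * r))) + ‖T t‖ * (M * ‖y‖) * Real.exp (-(c * r))) atTop (nhds 0) := by
      simpa using (hdecay'.const_mul (‖T t‖ * (M * ‖A y‖ + |a| * M * ‖y‖))).add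
        (hdecay.const_mul (‖T t‖ * (M * ‖y‖)))
    refine squeeze_zero_norm' ?_ hmajor
    filter_upwards [eventually_ge_atTop 0] with r hr
    have her : 0 ≤ e r := (Real.exp_pos _).le
    have hkr : |k r| ≤ r := (hkb r).trans_eq (abs_of_nonneg hr)
    have hTr : ∀ z, ‖T r z‖ ≤ M * Real.exp (ω * r) * ‖z‖ := fun z =>
      (T r).le_of_opNorm_le (hbound r hr) z
    have hcoef : |a * k r + k' r| ≤ |a| * r + 1 := by
      refine (abs_add_le _ _).trans (add_le_add ?_ (hk'b r))
      rw [abs_mul]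
      gcongr
    calc ‖G r‖ ≤ ‖T t‖ * ‖(e r * k r) • T r (A y) - (e r * (a * k r + k' r)) • T r y‖ :=
          (T t).le_opNorm _
      _ ≤ ‖T t‖ * (e r * r * (M * Real.exp (ω * r) * ‖A y‖) +
            e r * (|a| * r + 1) * (M * Real.exp (ω * r) * ‖y‖)) := by
          gcongr
          refine (norm_sub_le _ _).trans (add_le_add ?_ ?_)
          · rw [norm_smul, Real.norm_eq_abs, abs_mul, abs_of_nonneg her]
            gcongr
            exact hTr _
          · rw [norm_smul, Real.norm_eq_abs, abs_mul, abs_of_nonneg her]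
            gcongr
            exact hTr _
      _ = ‖T t‖ * (M * ‖A y‖ + |a| * M * ‖y‖) * (r * (e r * Real.exp (ω * r))) +
            ‖T t‖ * (M * ‖y‖) * (e r * Real.exp (ω * r)) := by ring
      _ = _ := by rw [hee]
  have hfinal : ‖T t y‖ ≤ D / c ^ 2 := by
    refine ge_of_tendsto (x := atTop) (f := fun r : ℝ => D / c ^ 2 + ‖G r‖) ?_ ?_
    · simpa using hGlim.norm.const_add (D / c ^ 2)
    · filter_upwards [eventually_ge_atTop 0] with r hr using hGle r hr
  exact hfinal.trans_eq (by rw [hD]; ring)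

end

theorem stmt_7 {X : Type*} [NormedAddCommGroup X] [NormedSpace ℝ X] [CompleteSpace X]
    (T : ℝ → X →L[ℝ] X) (hT : IsSCSemigroup T) (A : X → X) (hA : IsGenerator T A)
    (ω M : ℝ) (hM : 0 ≤ M) (hbound : ∀ t : ℝ, 0 ≤ t → ‖T t‖ ≤ M * Real.exp (ω * t))
    (a b : ℝ) (ha : ω < a) (Q : X →L[ℝ] X)
    (hQleft : ∀ x ∈ iterDomain T A 2,
      Q (A^[2] x - (2 * a) • A x + (a ^ 2 + b ^ 2) • x) = x)
    (hQright : ∀ x : X, Q x ∈ iterDomain T A 2 ∧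
      A^[2] (Q x) - (2 * a) • A (Q x) + (a ^ 2 + b ^ 2) • Q x = x) :
    ∀ n : ℕ, 1 ≤ n → ‖Q ^ n‖ ≤ M / (a - ω) ^ (2 * n) := by
  have horbit : ∀ (n : ℕ) (x : X) (t : ℝ), 0 ≤ t →
      ‖T t ((Q ^ n) x)‖ ≤ M * ‖x‖ / (a - ω) ^ (2 * n) * Real.exp (ω * t) := by
    intro n x
    induction n with
    | zero =>
      intro t ht
      simpa [mul_right_comm] using (T t).le_of_opNorm_le (hbound t ht) x
    | succ n ih =>
      intro t ht
      obtain ⟨⟨⟨-, hy⟩, hAy⟩, hxy⟩ := hQright ((Q ^ n) x)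
      have h := hT.norm_orbit_le_of_quadratic hA hbound ha hy hAy hxy ih ht
      rw [pow_succ', mul_add, pow_add, ← div_div]
      exact h
  intro n _
  have hc : 0 < a - ω := sub_pos.2 ha
  refine (Q ^ n).opNorm_le_bound (by positivity) fun x => ?_
  have h := horbit n x 0 le_rfl
  rw [hT.1] at h
  simpa [div_mul_eq_mul_div] using h
end
end

section
/- Let X be a real Banach space, let T : [0,∞) → B(X) be a strongly continuous semigroup, and let g : [0,∞) → ℝ be continuously differentiable with ∫_0^∞ ‖T(t)‖ |g(t)| dt < ∞ and ∫_0^∞ ‖T(t)‖ |g'(t)| dt < ∞. Then for every x ∈ X, lim_{h → 0+} ‖ ∫_h^∞ ((g(t−h) − g(t))/h) · T(t)x dt + ∫_0^∞ g'(t) · T(t)x dt ‖ = 0. -/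
open MeasureTheory Filter Set Quaternion

noncomputable section

theorem setIntegral_Ioi_comp_sub_right {E : Type*} [NormedAddCommGroup E] [NormedSpace ℝ E]
    (f : ℝ → E) (a r : ℝ) : ∫ t in Ioi a, f (t - r) = ∫ s in Ioi (a - r), f s := by
  have := (measurePreserving_sub_right (volume : Measure ℝ) r).setIntegral_preimage_emb
    (measurableEmbedding_subRight r) f (Ioi (a - r))
  simpa using this

theorem integrableOn_Ioi_comp_sub_right {E : Type*} [NormedAddCommGroup E]
    {f : ℝ → E} {a r : ℝ} (hf : IntegrableOn f (Ioi (a - r))) :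
    IntegrableOn (fun t => f (t - r)) (Ioi a) := by
  have := ((measurePreserving_sub_right (volume : Measure ℝ) r).integrableOn_comp_preimage
    (measurableEmbedding_subRight r)).2 hf
  simpa [Function.comp_def] using this

section Kernel

variable {X : Type*} [NormedAddCommGroup X] [NormedSpace ℝ X] {k : ℝ → ℝ} {u : ℝ → X}
  {B : ℝ → ℝ} {h : ℝ}

theorem integrableOn_smul_translate (hk : Continuous k) (hu : Continuous u)
    (hB : IntegrableOn B (Ioi 0)) {r : ℝ} (hbd : ∀ s > 0, ‖k s • u (s + r)‖ ≤ B s) :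
    IntegrableOn (fun s => k s • u (s + r)) (Ioi 0) := by
  refine Integrable.mono' hB (Continuous.aestronglyMeasurable (by fun_prop)) ?_
  exact (ae_restrict_iff' measurableSet_Ioi).2 (Eventually.of_forall hbd)

theorem integrable_smul_translate_prod (hk : Continuous k) (hu : Continuous u)
    (hB : IntegrableOn B (Ioi 0))
    (hbd : ∀ r ∈ Ioc 0 h, ∀ s > 0, ‖k s • u (s + r)‖ ≤ B s) :
    Integrable (fun p : ℝ × ℝ => k (p.1 - p.2) • u p.1)
      ((volume.restrict (Ioi h)).prod (volume.restrict (Ioc 0 h))) := by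
  have hmeas : AEStronglyMeasurable (fun p : ℝ × ℝ => k (p.1 - p.2) • u p.1)
      ((volume.restrict (Ioi h)).prod (volume.restrict (Ioc 0 h))) :=
    Continuous.aestronglyMeasurable (by fun_prop)
  refine (integrable_prod_iff' hmeas).2 ⟨?_, ?_⟩
  · refine (ae_restrict_iff' measurableSet_Ioc).2 (Eventually.of_forall fun r hr => ?_)
    have := integrableOn_Ioi_comp_sub_right (a := h) (r := r)
      ((integrableOn_smul_translate hk hu hB (hbd r hr)).mono_set
        (Ioi_subset_Ioi (sub_nonneg.2 hr.2)))
    simpa [IntegrableOn] using this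
  · refine Integrable.mono' (g := fun _ => ∫ s in Ioi 0, B s) (integrable_const _)
      hmeas.norm.prod_swap.integral_prod_right' ?_
    refine (ae_restrict_iff' measurableSet_Ioc).2 (Eventually.of_forall fun r hr => ?_)
    have hi := (integrableOn_smul_translate hk hu hB (hbd r hr)).norm
    have hsub : Ioi (h - r) ⊆ Ioi (0 : ℝ) := Ioi_subset_Ioi (sub_nonneg.2 hr.2)
    have htr := setIntegral_Ioi_comp_sub_right (fun s => ‖k s • u (s + r)‖) h r
    simp only [sub_add_cancel] at htr
    rw [Real.norm_of_nonneg (integral_nonneg fun _ => norm_nonneg _), htr]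
    calc ∫ s in Ioi (h - r), ‖k s • u (s + r)‖
        ≤ ∫ s in Ioi 0, ‖k s • u (s + r)‖ :=
          setIntegral_mono_set hi (Eventually.of_forall fun _ => norm_nonneg _)
            hsub.eventuallyLE
      _ ≤ ∫ s in Ioi 0, B s := setIntegral_mono_on hi hB measurableSet_Ioi (hbd r hr)

theorem integrableOn_setIntegral_smul_translate [CompleteSpace X]
    (hk : Continuous k) (hu : Continuous u) (hB : IntegrableOn B (Ioi 0))
    (hbd : ∀ r ∈ Ioc 0 h, ∀ s > 0, ‖k s • u (s + r)‖ ≤ B s) :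
    IntegrableOn (fun r => ∫ s in Ioi (h - r), k s • u (s + r)) (Ioc 0 h) := by
  have := (integrable_smul_translate_prod hk hu hB hbd).integral_prod_right
  refine Integrable.congr this (Eventually.of_forall fun r => ?_)
  simpa using setIntegral_Ioi_comp_sub_right (fun s => k s • u (s + r)) h r

/-- Fubini for the averaged kernel `∫ r in (0, h], k (t - r)` integrated against `u`. -/
theorem setIntegral_average_smul_eq [CompleteSpace X]
    (hk : Continuous k) (hu : Continuous u) (hB : IntegrableOn B (Ioi 0))
    (hbd : ∀ r ∈ Ioc 0 h, ∀ s > 0, ‖k s • u (s + r)‖ ≤ B s) :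
    ∫ t in Ioi h, (∫ r in Ioc 0 h, k (t - r)) • u t =
      ∫ r in Ioc 0 h, ∫ s in Ioi (h - r), k s • u (s + r) := by
  have := integral_integral_swap (f := fun t r => k (t - r) • u t)
    (integrable_smul_translate_prod hk hu hB hbd)
  simp only [integral_smul_const] at this
  rw [this]
  congr 1 with r
  simpa using setIntegral_Ioi_comp_sub_right (fun s => k s • u (s + r)) h r

/-- If translating `u` by `r ∈ (0, h]` and cutting off `(0, h - r]` moves the integral of `k • u` by
at most `ε`, then so does averaging over `r`. -/
theorem norm_average_sub_le [CompleteSpace X]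
    (hk : Continuous k) (hu : Continuous u) (hB : IntegrableOn B (Ioi 0)) (hh : 0 < h)
    (hbd : ∀ r ∈ Ioc 0 h, ∀ s > 0, ‖k s • u (s + r)‖ ≤ B s) {J : X} {ε : ℝ}
    (hε : ∀ r ∈ Ioc 0 h, ‖J - ∫ s in Ioi (h - r), k s • u (s + r)‖ ≤ ε) :
    ‖J - (1 / h) • ∫ t in Ioi h, (∫ r in Ioc 0 h, k (t - r)) • u t‖ ≤ ε := by
  have hint := integrableOn_setIntegral_smul_translate hk hu hB hbd
  have hJ : J = (1 / h) • ∫ _ in Ioc 0 h, J := by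
    simp [hh.le, smul_smul, inv_mul_cancel₀ hh.ne']
  have hle := norm_setIntegral_le_of_norm_le_const (μ := volume) measure_Ioc_lt_top hε
  rw [integral_sub (integrable_const J) hint] at hle
  rw [setIntegral_average_smul_eq hk hu hB hbd]
  nth_rw 1 [hJ]
  rw [← smul_sub, norm_smul, Real.norm_of_nonneg (by positivity), one_div,
    inv_mul_le_iff₀ hh, mul_comm]
  simpa [hh.le] using hle

end Kernel

theorem IsSCSemigroup.exists_norm_le {X : Type*} [NormedAddCommGroup X] [NormedSpace ℝ X]
    [CompleteSpace X] {T : ℝ → X →L[ℝ] X} (hT : IsSCSemigroup T) :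
    ∃ M, 0 ≤ M ∧ ∀ t ∈ Icc (0 : ℝ) 1, ‖T t‖ ≤ M := by
  obtain ⟨C, hC⟩ := banach_steinhaus (g := fun t : Icc (0 : ℝ) 1 => T t) fun x => by
    obtain ⟨C, hC⟩ := isCompact_Icc.exists_bound_of_continuousOn
      ((hT.2.2 x).mono (Icc_subset_Ici_self : Icc (0 : ℝ) 1 ⊆ _))
    exact ⟨C, fun t => hC t t.2⟩
  exact ⟨C, (norm_nonneg _).trans (hC ⟨0, by simp⟩), fun t ht => hC ⟨t, ht⟩⟩

theorem setIntegral_deriv_sub_eq {g g' : ℝ → ℝ}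
    (hderiv : ∀ t ∈ Ici (0 : ℝ), HasDerivWithinAt g (g' t) (Ici 0) t)
    (hg' : ContinuousOn g' (Ici 0)) {h t : ℝ} (hh : 0 ≤ h) (ht : h ≤ t) :
    ∫ r in Ioc 0 h, g' (max (t - r) 0) = g t - g (t - h) := by
  have h0 : 0 ≤ t - h := sub_nonneg.2 ht
  have hsub : Icc (t - h) t ⊆ Ici 0 := fun y hy => h0.trans hy.1
  rw [← intervalIntegral.integral_of_le hh,
    intervalIntegral.integral_comp_sub_left (fun y => g' (max y 0)) t, sub_zero]
  rw [intervalIntegral.integral_congr (g := g') fun y hy => by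
    rw [uIcc_of_le (by linarith)] at hy
    exact congrArg g' (max_eq_left (hsub hy))]
  refine intervalIntegral.integral_eq_sub_of_hasDerivAt_of_le (by linarith)
    (fun y hy => ((hderiv y (hsub hy)).continuousWithinAt).mono hsub) (fun y hy => ?_)
    (ContinuousOn.intervalIntegrable ?_)
  · exact (hderiv y (h0.trans hy.1.le)).hasDerivAt (Ici_mem_nhds (h0.trans_lt hy.1))
  · rw [uIcc_of_le (by linarith)]
    exact hg'.mono hsub

theorem stmt_12 {X : Type*} [NormedAddCommGroup X] [NormedSpace ℝ X] [CompleteSpace X]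
    (T : ℝ → X →L[ℝ] X) (hT : IsSCSemigroup T)
    (g g' : ℝ → ℝ)
    (hderiv : ∀ t ∈ Set.Ici (0 : ℝ), HasDerivWithinAt g (g' t) (Set.Ici 0) t)
    (hg' : ContinuousOn g' (Set.Ici 0))
    (hint : IntegrableOn (fun t => ‖T t‖ * |g t|) (Set.Ioi 0))
    (hint' : IntegrableOn (fun t => ‖T t‖ * |g' t|) (Set.Ioi 0)) :
    ∀ x : X,
      Tendsto (fun h : ℝ =>
          ‖(∫ t in Set.Ioi h, ((g (t - h) - g t) / h) • T t x) +
            ∫ t in Set.Ioi (0 : ℝ), g' t • T t x‖)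
        (nhdsWithin 0 (Set.Ioi 0)) (nhds 0) := by
  intro x
  obtain ⟨M, hM0, hM⟩ := hT.exists_norm_le
  obtain ⟨h0, hadd, hcont⟩ := hT
  set k : ℝ → ℝ := fun t => g' (max t 0) with hkdef
  set u : ℝ → X := fun t => T (max t 0) x with hudef
  have hmax : Continuous fun t : ℝ => max t 0 := by fun_prop
  have hk : Continuous k := hg'.comp_continuous hmax fun t => le_max_right t 0
  have hu : Continuous u := (hcont x).comp_continuous hmax fun t => le_max_right t 0
  have hk' : ∀ t, 0 ≤ t → k t = g' t := fun t ht => by simp [hkdef, ht]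
  have hu' : ∀ t, 0 ≤ t → u t = T t x := fun t ht => by simp [hudef, ht]
  have hus : ∀ r, 0 ≤ r → ∀ s, 0 ≤ s → u (s + r) = T s (T r x) := fun r hr s hs => by
    rw [hu' _ (add_nonneg hs hr), hadd r s hr hs, ContinuousLinearMap.comp_apply]
  have hnorm : ∀ s, 0 ≤ s → ∀ y, ‖k s • T s y‖ ≤ ‖T s‖ * |g' s| * ‖y‖ := fun s hs y => by
    rw [norm_smul, hk' s hs, Real.norm_eq_abs, mul_comm ‖T s‖, mul_assoc]
    gcongr
    exact (T s).le_opNorm y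
  have hB : IntegrableOn (fun s => ‖T s‖ * |g' s| * (M * ‖x‖)) (Ioi 0) := hint'.mul_const _
  have hbd : ∀ r ∈ Icc (0 : ℝ) 1, ∀ s > 0, ‖k s • u (s + r)‖ ≤ ‖T s‖ * |g' s| * (M * ‖x‖) :=
    fun r hr s hs => by
      rw [hus r hr.1 s hs.le]
      refine (hnorm s hs.le _).trans ?_
      gcongr
      exact (T r).le_of_opNorm_le (hM r hr) x
  set C := ∫ s in Ioi 0, ‖T s‖ * |g' s| with hC
  have hC0 : 0 ≤ C := integral_nonneg fun _ => by positivity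
  obtain ⟨K, hK⟩ := (isCompact_Icc (a := (0 : ℝ)) (b := 1)).exists_bound_of_continuousOn
    hk.continuousOn
  have hK0 : 0 ≤ K := (norm_nonneg _).trans (hK 0 (by simp))
  set J := ∫ t in Ioi (0 : ℝ), g' t • T t x with hJ
  have hJu : J = ∫ s in Ioi 0, k s • u (s + 0) :=
    setIntegral_congr_fun measurableSet_Ioi fun s hs => by
      simp [hk' s (le_of_lt hs), hu' s (le_of_lt hs)]
  have hi : ∀ r ∈ Icc (0 : ℝ) 1, IntegrableOn (fun s => k s • u (s + r)) (Ioi 0) :=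
    fun r hr => integrableOn_smul_translate hk hu hB (hbd r hr)
  have hest : ∀ h ≤ 1, ∀ r ∈ Ioc 0 h, ‖J - ∫ s in Ioi (h - r), k s • u (s + r)‖ ≤
      C * ‖x - T r x‖ + K * (M * ‖x‖) * h := by
    intro h h1 r hr
    have hr1 : r ∈ Icc (0 : ℝ) 1 := ⟨hr.1.le, hr.2.trans h1⟩
    have hhr : 0 ≤ h - r := sub_nonneg.2 hr.2
    have hsplit : ∫ s in Ioi 0, k s • u (s + r) =
        (∫ s in Ioc 0 (h - r), k s • u (s + r)) + ∫ s in Ioi (h - r), k s • u (s + r) := by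
      rw [← Ioc_union_Ioi_eq_Ioi hhr]
      exact setIntegral_union Ioc_disjoint_Ioi_same measurableSet_Ioi
        ((hi r hr1).mono_set Ioc_subset_Ioi_self) ((hi r hr1).mono_set (Ioi_subset_Ioi hhr))
    have htrans : ‖J - ∫ s in Ioi 0, k s • u (s + r)‖ ≤ C * ‖x - T r x‖ := by
      rw [hJu, ← integral_sub (hi 0 (by simp)) (hi r hr1), hC, ← integral_mul_const]
      refine norm_integral_le_of_norm_le (hint'.mul_const _)
        ((ae_restrict_iff' measurableSet_Ioi).2 (Eventually.of_forall fun s hs => ?_))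
      have hs0 : 0 ≤ s := le_of_lt hs
      rw [hus r hr.1.le s hs0, add_zero, hu' s hs0, ← smul_sub, ← map_sub]
      exact hnorm s hs0 _
    have hcut : ‖∫ s in Ioc 0 (h - r), k s • u (s + r)‖ ≤ K * (M * ‖x‖) * h := by
      have := norm_setIntegral_le_of_norm_le_const (μ := volume) (s := Ioc 0 (h - r))
        (f := fun s => k s • u (s + r)) (C := K * (M * ‖x‖)) measure_Ioc_lt_top
        fun s hs => by
          have hs1 : s + r ∈ Icc (0 : ℝ) 1 :=
            ⟨add_nonneg hs.1.le hr.1.le, by linarith [hs.2]⟩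
          rw [norm_smul, hu' _ hs1.1]
          gcongr
          · exact hK s ⟨hs.1.le, by linarith [hs1.2, hr.1]⟩
          · exact (T (s + r)).le_of_opNorm_le (hM _ hs1) x
      refine this.trans ?_
      gcongr
      simpa [hhr] using hr.1.le
    rw [show J - ∫ s in Ioi (h - r), k s • u (s + r) =
      (J - ∫ s in Ioi 0, k s • u (s + r)) + ∫ s in Ioc 0 (h - r), k s • u (s + r) by
        rw [hsplit]; abel]
    exact (norm_add_le _ _).trans (add_le_add htrans hcut)
  have hrw : ∀ h > 0, (∫ t in Ioi h, ((g (t - h) - g t) / h) • T t x) =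
      -((1 / h) • ∫ t in Ioi h, (∫ r in Ioc 0 h, k (t - r)) • u t) := by
    intro h hh
    rw [← integral_smul, ← integral_neg]
    refine setIntegral_congr_fun measurableSet_Ioi fun t ht => ?_
    have ht' : h < t := ht
    simp only [hkdef]
    rw [setIntegral_deriv_sub_eq hderiv hg' hh.le ht'.le, hu' t (hh.trans ht').le, smul_smul,
      ← neg_smul]
    congr 1
    ring
  have hlim : Tendsto (fun r => C * ‖x - u r‖) (nhds 0) (nhds 0) := by
    have : Continuous fun r => C * ‖x - u r‖ := by fun_prop
    simpa [hu' 0 le_rfl, h0] using this.tendsto 0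
  have hlim' : Tendsto (fun h => K * (M * ‖x‖) * h) (nhds 0) (nhds 0) := by
    have : Continuous fun h => K * (M * ‖x‖) * h := by fun_prop
    simpa using this.tendsto 0
  refine Metric.tendsto_nhds.2 fun ε hε => ?_
  obtain ⟨δ, hδ, hδε⟩ := Metric.eventually_nhds_iff.1
    ((hlim.eventually_lt_const (show 0 < ε / 4 by positivity)).and
      (hlim'.eventually_lt_const (show 0 < ε / 4 by positivity)))
  filter_upwards [Ioo_mem_nhdsGT (show 0 < min δ 1 by positivity)] with h hh
  have hhδ : h < δ := hh.2.trans_le (min_le_left _ _)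
  have hh1 : h ≤ 1 := (hh.2.trans_le (min_le_right _ _)).le
  have hfin := norm_average_sub_le hk hu hB hh.1
    (fun r hr => hbd r ⟨hr.1.le, hr.2.trans hh1⟩) (J := J) (ε := ε / 2) fun r hr => by
      refine (hest h hh1 r hr).trans ?_
      have h₁ := (hδε (y := r) (by
        rw [Real.dist_eq, sub_zero, abs_of_pos hr.1]; exact hr.2.trans_lt hhδ)).1
      have h₂ := (hδε (y := h) (by rwa [Real.dist_eq, sub_zero, abs_of_pos hh.1])).2
      rw [hu' r hr.1.le] at h₁
      linarith
  rw [hrw h hh.1, neg_add_eq_sub, Real.dist_eq, sub_zero, abs_norm]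
  linarith
end
end

section
/- Let X be a real Banach space, let T : [0,∞) → B(X) be a strongly continuous semigroup with generator A, let m ∈ ℕ, and let g : [0,∞) → ℝ be of class C^{m+2} with ∫_0^∞ ‖T(t)‖ |g^{(k)}(t)| dt < ∞ for every 0 ≤ k ≤ m+2, and with g(0) = g'(0) = ⋯ = g^{(m)}(0) = 0. Define L(f)x := ∫_0^∞ f(t) · T(t)x dt for such integrable f. Then for every x ∈ X: L(g)x ∈ D(A^{m+2}); A^k(L(g)x) = (−1)^k L(g^{(k)})x for every 0 ≤ k ≤ m+1; and A^{m+2}(L(g)x) = (−1)^{m+2} ( g^{(m+1)}(0) x + L(g^{(m+2)})x ). -/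
open MeasureTheory Filter Set Quaternion

noncomputable section

section LaplaceTransform

variable {X : Type*} [NormedAddCommGroup X] [NormedSpace ℝ X]

theorem IsSCSemigroup.continuous_orbit {T : ℝ → X →L[ℝ] X} (hT : IsSCSemigroup T) (x : X) :
    Continuous fun t => T (max t 0) x :=
  (hT.2.2 x).comp_continuous (continuous_id.max continuous_const) fun t => le_max_right t 0

theorem norm_smul_semigroup_le (T : ℝ → X →L[ℝ] X) (f : ℝ → ℝ) (x : X) (t : ℝ) :
    ‖f t • T t x‖ ≤ ‖T t‖ * |f t| * ‖x‖ := by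
  rw [norm_smul, Real.norm_eq_abs]
  calc |f t| * ‖T t x‖ ≤ |f t| * (‖T t‖ * ‖x‖) := by gcongr; exact (T t).le_opNorm x
    _ = ‖T t‖ * |f t| * ‖x‖ := by ring

theorem IsSCSemigroup.integrableOn_smul_s14 {T : ℝ → X →L[ℝ] X} (hT : IsSCSemigroup T)
    {f : ℝ → ℝ} (hf : ContinuousOn f (Ici 0))
    (hint : IntegrableOn (fun t => ‖T t‖ * |f t|) (Ioi 0)) (x : X) :
    IntegrableOn (fun t => f t • T t x) (Ioi 0) := by
  refine (hint.mul_const ‖x‖).mono' ?_ (ae_of_all _ (norm_smul_semigroup_le T f x))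
  exact ((hf.smul (hT.2.2 x)).mono Ioi_subset_Ici_self).aestronglyMeasurable measurableSet_Ioi

theorem IsSCSemigroup.continuous_integral_smul {T : ℝ → X →L[ℝ] X} (hT : IsSCSemigroup T)
    {f : ℝ → ℝ} (hf : ContinuousOn f (Ici 0))
    (hint : IntegrableOn (fun t => ‖T t‖ * |f t|) (Ioi 0)) :
    Continuous fun x => ∫ t in Ioi (0 : ℝ), f t • T t x := by
  let L : X →ₗ[ℝ] X :=
    { toFun := fun x => ∫ t in Ioi (0 : ℝ), f t • T t x
      map_add' := fun x y => by
        simp only [map_add, smul_add]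
        exact integral_add (hT.integrableOn_smul_s14 hf hint x) (hT.integrableOn_smul_s14 hf hint y)
      map_smul' := fun c x => by
        simp only [map_smul, smul_comm _ c, RingHom.id_apply]
        exact integral_smul c _ }
  refine (L.mkContinuous (∫ t in Ioi (0 : ℝ), ‖T t‖ * |f t|) fun x => ?_).continuous
  rw [← integral_mul_const]
  exact norm_integral_le_of_norm_le (hint.mul_const ‖x‖)
    (ae_of_all _ (norm_smul_semigroup_le T f x))

variable [CompleteSpace X]

/-- The semigroup applied to the orbit integral `∫ r in 0..h, T r x` is a translated orbit
integral. -/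
theorem IsSCSemigroup.apply_orbit_integral {T : ℝ → X →L[ℝ] X} (hT : IsSCSemigroup T)
    (x : X) {h u : ℝ} (hh : 0 ≤ h) (hu : 0 ≤ u) :
    T u (∫ r in (0 : ℝ)..h, T (max r 0) x) =
      (∫ r in (0 : ℝ)..(u + h), T (max r 0) x) - ∫ r in (0 : ℝ)..u, T (max r 0) x := by
  have hi : ∀ a b : ℝ, IntervalIntegrable (fun r => T (max r 0) x) volume a b :=
    (hT.continuous_orbit x).intervalIntegrable
  rw [intervalIntegral.integral_interval_sub_left (hi _ _) (hi _ _),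
    ← (T u).intervalIntegral_comp_comm (hi _ _)]
  have key := intervalIntegral.integral_comp_add_left
    (a := 0) (b := h) (fun r => T (max r 0) x) u
  rw [add_zero] at key
  rw [← key]
  refine intervalIntegral.integral_congr fun r hr => ?_
  rw [uIcc_of_le hh] at hr
  simp only [max_eq_left hr.1, max_eq_left (add_nonneg hu hr.1)]
  rw [hT.2.1 r u hr.1 hu, ContinuousLinearMap.comp_apply]

theorem IsSCSemigroup.hasDerivAt_orbit_integral {T : ℝ → X →L[ℝ] X} (hT : IsSCSemigroup T)
    (x : X) (u : ℝ) :
    HasDerivAt (fun u => ∫ r in (0 : ℝ)..u, T (max r 0) x) (T (max u 0) x) u :=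
  (hT.continuous_orbit x).integral_hasStrictDerivAt 0 u |>.hasDerivAt

theorem IsSCSemigroup.apply_sub_integral_smul {T : ℝ → X →L[ℝ] X} (hT : IsSCSemigroup T)
    {f f' : ℝ → ℝ} (hf : ∀ t ∈ Ici (0 : ℝ), HasDerivWithinAt f (f' t) (Ici 0) t)
    (hf' : ContinuousOn f' (Ici 0))
    (hint : IntegrableOn (fun t => ‖T t‖ * |f t|) (Ioi 0))
    (hint' : IntegrableOn (fun t => ‖T t‖ * |f' t|) (Ioi 0)) (x : X) {h : ℝ} (hh : 0 ≤ h) :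
    T h (∫ t in Ioi (0 : ℝ), f t • T t x) - (∫ t in Ioi (0 : ℝ), f t • T t x) =
      -(f 0 • (∫ r in (0 : ℝ)..h, T (max r 0) x) +
        ∫ t in Ioi (0 : ℝ), f' t • T t (∫ r in (0 : ℝ)..h, T (max r 0) x)) := by
  have hfc : ContinuousOn f (Ici 0) := fun t ht => (hf t ht).continuousWithinAt
  set y := ∫ r in (0 : ℝ)..h, T (max r 0) x
  have hfx := hT.integrableOn_smul_s14 hfc hint x
  have hfTx : IntegrableOn (fun t => T h (f t • T t x)) (Ioi 0) := (T h).integrable_comp hfx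
  have hfy := hT.integrableOn_smul_s14 hfc hint y
  have hf'y := hT.integrableOn_smul_s14 hf' hint' y
  have hderiv : ∀ t ∈ Ioi (0 : ℝ), HasDerivAt (fun t => f t • T t y)
      ((T h (f t • T t x) - f t • T t x) + f' t • T t y) t := by
    intro t ht
    have ht0 : (0 : ℝ) ≤ t := le_of_lt ht
    have h1 : HasDerivAt f (f' t) t := (hf t ht0).hasDerivAt (Ici_mem_nhds ht)
    have h2 : HasDerivAt (fun u => T u y) (T h (T t x) - T t x) t := by
      have h3 := ((hT.hasDerivAt_orbit_integral x (t + h)).comp_add_const t h).sub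
        (hT.hasDerivAt_orbit_integral x t)
      rw [max_eq_left ht0, max_eq_left (add_nonneg ht0 hh), add_comm t h,
        hT.2.1 t h ht0 hh, ContinuousLinearMap.comp_apply] at h3
      refine h3.congr_of_eventuallyEq ?_
      filter_upwards [Ioi_mem_nhds ht] with u hu
      exact hT.apply_orbit_integral x hh (le_of_lt hu)
    rw [map_smul, ← smul_sub]
    exact h1.smul h2
  have hsub : IntegrableOn (fun t => T h (f t • T t x) - f t • T t x) (Ioi 0) := hfTx.sub hfx
  have hFint := hsub.add hf'y
  have hcont : ContinuousWithinAt (fun t => f t • T t y) (Ici 0) 0 :=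
    (hfc.smul (hT.2.2 y)) 0 self_mem_Ici
  have key := integral_Ioi_of_hasDerivAt_of_tendsto hcont hderiv hFint
    (tendsto_zero_of_hasDerivAt_of_integrableOn_Ioi hderiv hFint hfy)
  rw [integral_add hsub hf'y, integral_sub hfTx hfx,
    (T h).integral_comp_comm hfx, hT.1] at key
  rw [eq_sub_of_add_eq key]
  simp only [one_apply_eq_self]
  abel

theorem IsSCSemigroup.tendsto_average {T : ℝ → X →L[ℝ] X} (hT : IsSCSemigroup T) (x : X) :
    Tendsto (fun h : ℝ => (1 / h) • ∫ r in (0 : ℝ)..h, T (max r 0) x) (nhdsWithin 0 (Ioi 0))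
      (nhds x) := by
  have h1 := (hT.hasDerivAt_orbit_integral x 0).tendsto_slope_zero_right
  simpa [hT.1] using h1

theorem IsSCSemigroup.tendsto_quotient_integral_smul {T : ℝ → X →L[ℝ] X} (hT : IsSCSemigroup T)
    {f f' : ℝ → ℝ} (hf : ∀ t ∈ Ici (0 : ℝ), HasDerivWithinAt f (f' t) (Ici 0) t)
    (hf' : ContinuousOn f' (Ici 0))
    (hint : IntegrableOn (fun t => ‖T t‖ * |f t|) (Ioi 0))
    (hint' : IntegrableOn (fun t => ‖T t‖ * |f' t|) (Ioi 0)) (x : X) (c : ℝ) :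
    Tendsto (fun h : ℝ => (1 / h) • (T h (c • ∫ t in Ioi (0 : ℝ), f t • T t x) -
        c • ∫ t in Ioi (0 : ℝ), f t • T t x)) (nhdsWithin 0 (Ioi 0))
      (nhds (-c • (f 0 • x + ∫ t in Ioi (0 : ℝ), f' t • T t x))) := by
  have hav := hT.tendsto_average x
  have hL := ((hT.continuous_integral_smul hf' hint').tendsto x).comp hav
  refine (((hav.const_smul (f 0)).add hL).const_smul (-c)).congr' ?_
  filter_upwards [self_mem_nhdsWithin] with h hh
  rw [map_smul, ← smul_sub, hT.apply_sub_integral_smul hf hf' hint hint' x (le_of_lt hh)]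
  simp only [Function.comp_apply, map_smul, smul_comm _ (1 / h), integral_smul]
  simp only [← smul_add, smul_neg, neg_smul, smul_comm _ (1 / h)]

end LaplaceTransform

theorem stmt_14 {X : Type*} [NormedAddCommGroup X] [NormedSpace ℝ X] [CompleteSpace X]
    (T : ℝ → X →L[ℝ] X) (hT : IsSCSemigroup T) (A : X → X) (hA : IsGenerator T A)
    (m : ℕ) (g : ℝ → ℝ) (hg : ContDiffOn ℝ (m + 2 : ℕ) g (Set.Ici 0))
    (hint : ∀ k ≤ m + 2,
      IntegrableOn (fun t => ‖T t‖ * |iteratedDerivWithin k g (Set.Ici 0) t|) (Set.Ioi 0))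
    (hInit : ∀ k ≤ m, iteratedDerivWithin k g (Set.Ici 0) 0 = 0) :
    ∀ x : X,
      (∫ t in Set.Ioi (0 : ℝ), g t • T t x) ∈ iterDomain T A (m + 2) ∧
      (∀ k ≤ m + 1,
        A^[k] (∫ t in Set.Ioi (0 : ℝ), g t • T t x) =
          (-1 : ℝ) ^ k • ∫ t in Set.Ioi (0 : ℝ), iteratedDerivWithin k g (Set.Ici 0) t • T t x) ∧
      A^[m + 2] (∫ t in Set.Ioi (0 : ℝ), g t • T t x) =
        (-1 : ℝ) ^ (m + 2) • (iteratedDerivWithin (m + 1) g (Set.Ici 0) 0 • x +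
          ∫ t in Set.Ioi (0 : ℝ), iteratedDerivWithin (m + 2) g (Set.Ici 0) t • T t x) := by
  intro x
  have hu : UniqueDiffOn ℝ (Ici (0 : ℝ)) := uniqueDiffOn_Ici 0
  have hstep : ∀ k ≤ m + 1, Tendsto (fun h : ℝ => (1 / h) •
      (T h ((-1 : ℝ) ^ k • ∫ t in Ioi (0 : ℝ), iteratedDerivWithin k g (Ici 0) t • T t x) -
        (-1 : ℝ) ^ k • ∫ t in Ioi (0 : ℝ), iteratedDerivWithin k g (Ici 0) t • T t x))
      (nhdsWithin 0 (Ioi 0))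
      (nhds ((-1 : ℝ) ^ (k + 1) • (iteratedDerivWithin k g (Ici 0) 0 • x +
        ∫ t in Ioi (0 : ℝ), iteratedDerivWithin (k + 1) g (Ici 0) t • T t x))) := by
    intro k hk
    rw [show (-1 : ℝ) ^ (k + 1) = -(-1 : ℝ) ^ k by ring]
    refine hT.tendsto_quotient_integral_smul (fun t ht => ?_) ?_ (hint k (by lia))
      (hint (k + 1) (by lia)) x _
    · rw [iteratedDerivWithin_succ]
      exact (hg.differentiableOn_iteratedDerivWithin
        (by exact_mod_cast Nat.lt_succ_of_le hk) hu t ht).hasDerivWithinAt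
    · exact hg.continuousOn_iteratedDerivWithin (by exact_mod_cast Nat.succ_le_succ hk) hu
  have hgen : ∀ z w : X,
      Tendsto (fun h : ℝ => (1 / h) • (T h z - z)) (nhdsWithin 0 (Ioi 0)) (nhds w) →
        A z = w := fun z w hw => tendsto_nhds_unique (hA z ⟨w, hw⟩) hw
  have hiter : ∀ k ≤ m + 1,
      (∫ t in Ioi (0 : ℝ), g t • T t x) ∈ iterDomain T A k ∧
      A^[k] (∫ t in Ioi (0 : ℝ), g t • T t x) =
        (-1 : ℝ) ^ k • ∫ t in Ioi (0 : ℝ), iteratedDerivWithin k g (Ici 0) t • T t x := by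
    intro k
    induction k with
    | zero => intro _; exact ⟨mem_univ _, by simp⟩
    | succ k ih =>
      intro hk
      obtain ⟨h1, h2⟩ := ih (by lia)
      have h3 := hstep k (by lia)
      refine ⟨⟨h1, ?_⟩, ?_⟩
      · rw [h2]; exact ⟨_, h3⟩
      · rw [Function.iterate_succ_apply', h2, hgen _ _ h3, hInit k (by lia), zero_smul, zero_add]
  obtain ⟨h1, h2⟩ := hiter (m + 1) le_rfl
  have h3 := hstep (m + 1) le_rfl
  refine ⟨⟨h1, ?_⟩, fun k hk => (hiter k hk).2, ?_⟩
  · rw [h2]; exact ⟨_, h3⟩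
  · rw [Function.iterate_succ_apply', h2, hgen _ _ h3]
end
end
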